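/- arXiv:1201.4713 — 14 statements merged into one kernel-verified Lean document; each statement's English description precedes it below -/
import Mathlib

section
/- Let E be an ellipse in a plane Π of ℝ³ with distinct foci F₁, F₂ and semi-major axis a, and let C be a cone (with some vertex V, axis direction d, and half-angle α) such that C ∩ Π = E. Then V lies in the plane Π′ through F₁ and F₂ perpendicular to Π, i.e. in the 2-dimensional affine subspace through F₁ whose direction is spanned by F₂ − F₁ and a unit normal vector of Π. -/
open scoped RealInnerProductSpace

/-- The (double-napped, right circular) cone with vertex `V`, axis direction `d`
and half-angle `α`: the set of `P` with `|⟪P − V, d⟫| = ‖P − V‖·cos α`. -/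
def Cone (V d : EuclideanSpace ℝ (Fin 3)) (α : ℝ) : Set (EuclideanSpace ℝ (Fin 3)) :=
  {P | |⟪P - V, d⟫| = ‖P - V‖ * Real.cos α}

/-- If a quadratic form of the type cutting out a cone vanishes along an ellipse with semi-axes
`b < a`, then its linear coefficient in the minor direction is zero. -/
lemma minor_coeff_eq_zero_of_forall_ellipse {a b k S N D₁ D₂ X₁ X₂ : ℝ} (hb : 0 < b)
    (hab : b < a) (hk : 0 < k)
    (h : ∀ t r : ℝ, t ^ 2 + r ^ 2 = 1 → (S + a * t * D₁ + b * r * D₂) ^ 2 =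
      k * (N + a ^ 2 * t ^ 2 + b ^ 2 * r ^ 2 + 2 * a * t * X₁ + 2 * b * r * X₂)) :
    X₂ = 0 := by
  have h₁ := h 1 0 (by norm_num)
  have h₂ := h (-1) 0 (by norm_num)
  have h₃ := h 0 1 (by norm_num)
  have h₄ := h 0 (-1) (by norm_num)
  have h₅ := h (3 / 5) (4 / 5) (by norm_num)
  have ha : 0 < a := hb.trans hab
  have hD : (a * b) * (D₁ * D₂) = 0 := by linarith
  have hS : b * (S * D₂ - k * X₂) = 0 := by linarith
  have hX : S * D₂ - k * X₂ = 0 := (mul_eq_zero.mp hS).resolve_left hb.ne'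
  have hD' : D₁ * D₂ = 0 := (mul_eq_zero.mp hD).resolve_left (by positivity)
  rcases mul_eq_zero.mp hD' with hD₁ | hD₂
  · subst hD₁
    have h₆ : b ^ 2 * D₂ ^ 2 = k * (b ^ 2 - a ^ 2) := by linarith
    have h₇ : b ^ 2 < a ^ 2 := by gcongr
    nlinarith [mul_pos hk (sub_pos.mpr h₇), sq_nonneg (b * D₂)]
  · subst hD₂
    have : k * X₂ = 0 := by linarith
    exact (mul_eq_zero.mp this).resolve_left hk.ne'

section InnerProductSpace

variable {W : Type*} [NormedAddCommGroup W] [InnerProductSpace ℝ W]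

lemma norm_sq_add_smul_add_smul {u w : W} (hu : ‖u‖ = 1) (hw : ‖w‖ = 1) (huw : ⟪u, w⟫ = 0)
    (X : W) (x y : ℝ) :
    ‖X + x • u + y • w‖ ^ 2 = ‖X‖ ^ 2 + x ^ 2 + y ^ 2 + 2 * x * ⟪X, u⟫ + 2 * y * ⟪X, w⟫ := by
  rw [norm_add_sq_real, norm_add_sq_real]
  simp only [inner_add_left, inner_smul_left, inner_smul_right, norm_smul, hu, hw, huw,
    Real.norm_eq_abs, mul_one, sq_abs, conj_trivial]
  ring

/-- The focal distance of the point with eccentric parameter `(t, r)` of an ellipse. -/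
lemma norm_ellipse_sub_focus {u w : W} (hu : ‖u‖ = 1) (hw : ‖w‖ = 1) (huw : ⟪u, w⟫ = 0)
    {a b c t r : ℝ} (ha : 0 < a) (hc : |c| < a) (hb : b ^ 2 = a ^ 2 - c ^ 2)
    (htr : t ^ 2 + r ^ 2 = 1) :
    ‖(a * t - c) • u + (b * r) • w‖ = a - c * t := by
  have ht : |t| ≤ 1 := by
    rw [← sq_le_one_iff_abs_le_one]
    nlinarith [sq_nonneg r]
  have hct : 0 ≤ a - c * t := by
    have h₁ : |c * t| ≤ a * 1 := by
      rw [abs_mul]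
      gcongr
    linarith [le_abs_self (c * t)]
  have h := norm_sq_add_smul_add_smul hu hw huw 0 (a * t - c) (b * r)
  simp only [zero_add, norm_zero, inner_zero_left] at h
  rw [← sq_eq_sq₀ (norm_nonneg _) hct, h]
  linear_combination r ^ 2 * hb + (a ^ 2 - c ^ 2) * htr

end InnerProductSpace

/-- The orthogonal complement of a normal vector of a plane in three-space is the plane. -/
lemma mem_of_inner_normal_eq_zero {K : Submodule ℝ (EuclideanSpace ℝ (Fin 3))}
    (hK : Module.finrank ℝ K = 2) {n w : EuclideanSpace ℝ (Fin 3)} (hn : n ≠ 0) (hnK : n ∈ Kᗮ)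
    (hw : ⟪n, w⟫ = 0) : w ∈ K := by
  have hsum := K.finrank_add_finrank_orthogonal
  rw [hK, finrank_euclideanSpace_fin] at hsum
  have hspan : Submodule.span ℝ {n} = Kᗮ := by
    apply Submodule.eq_of_le_of_finrank_eq
    · simpa using hnK
    · rw [finrank_span_singleton hn]
      omega
  rw [← K.orthogonal_orthogonal, ← hspan]
  exact Submodule.mem_orthogonal_singleton_iff_inner_right.mpr hw

/-- The vertex of any cone belonging to an ellipse `E` lies in the plane through the
foci of `E` perpendicular to the plane of `E`. -/
theorem cone_vertex_in_perpendicular_plane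
    (Pl : AffineSubspace ℝ (EuclideanSpace ℝ (Fin 3)))
    (hPl : Module.finrank ℝ Pl.direction = 2)
    (F₁ F₂ : EuclideanSpace ℝ (Fin 3)) (hF₁ : F₁ ∈ Pl) (hF₂ : F₂ ∈ Pl) (hFne : F₁ ≠ F₂)
    (a : ℝ) (ha : dist F₁ F₂ < 2 * a)
    (E : Set (EuclideanSpace ℝ (Fin 3)))
    (hE : E = {P | P ∈ Pl ∧ dist P F₁ + dist P F₂ = 2 * a})
    (V d : EuclideanSpace ℝ (Fin 3)) (hd : ‖d‖ = 1)
    (α : ℝ) (hα : α ∈ Set.Ioo 0 (Real.pi / 2))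
    (C : Set (EuclideanSpace ℝ (Fin 3))) (hC : C = Cone V d α)
    (hCE : C ∩ (Pl : Set (EuclideanSpace ℝ (Fin 3))) = E)
    (n : EuclideanSpace ℝ (Fin 3)) (hn : ‖n‖ = 1) (hnperp : n ∈ Pl.directionᗮ) :
    V ∈ AffineSubspace.mk' F₁ (Submodule.span ℝ {F₂ - F₁, n}) := by
  subst hE hC
  obtain ⟨c, hc⟩ : ∃ c, c = dist F₁ F₂ / 2 := ⟨_, rfl⟩
  have hc₀ : 0 < c := by
    have := dist_pos.mpr hFne
    linarith
  have hca : c < a := by linarith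
  obtain ⟨u, hu_def⟩ : ∃ u, u = (2 * c)⁻¹ • (F₂ - F₁) := ⟨_, rfl⟩
  have hF : F₂ - F₁ = (2 * c) • u := by
    rw [hu_def, smul_smul, mul_inv_cancel₀ (by positivity), one_smul]
  have hu : ‖u‖ = 1 := by
    rw [hu_def, norm_smul, ← dist_eq_norm, dist_comm, Real.norm_of_nonneg (by positivity), hc]
    field_simp
    exact div_self (dist_pos.mpr hFne).ne'
  have hF_dir : F₂ - F₁ ∈ Pl.direction := AffineSubspace.vsub_mem_direction hF₂ hF₁
  have huPl : u ∈ Pl.direction := hu_def ▸ Pl.direction.smul_mem _ hF_dir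
  have hun : ⟪u, n⟫ = 0 := hnperp u huPl
  have hnu : ⟪n, u⟫ = 0 := by rwa [real_inner_comm]
  obtain ⟨B, hB⟩ : ∃ B : OrthonormalBasis (Fin 3) ℝ (EuclideanSpace ℝ (Fin 3)),
      ∀ i ∈ ({0, 2} : Set (Fin 3)), B i = ![u, 0, n] i := by
    apply Orthonormal.exists_orthonormalBasis_extension_of_card_eq (by simp)
    rw [orthonormal_iff_ite]
    rintro ⟨i, rfl | rfl⟩ ⟨j, rfl | rfl⟩ <;>
      simp [hu, hn, hun, hnu, Subtype.ext_iff]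
  have hB₀ : B 0 = u := hB 0 (by simp)
  have hB₂ : B 2 = n := hB 2 (by simp)
  obtain ⟨w, hB₁⟩ : ∃ w, B 1 = w := ⟨_, rfl⟩
  have hw : ‖w‖ = 1 := hB₁ ▸ B.norm_eq_one 1
  have huw : ⟪u, w⟫ = 0 := by
    rw [← hB₀, ← hB₁]
    exact B.inner_eq_zero (by decide)
  have hnw : ⟪n, w⟫ = 0 := by
    rw [← hB₂, ← hB₁]
    exact B.inner_eq_zero (by decide)
  have hwPl : w ∈ Pl.direction :=
    mem_of_inner_normal_eq_zero hPl (norm_ne_zero_iff.mp (by simp [hn])) hnperp hnw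
  obtain ⟨b, hb₀, hb⟩ : ∃ b : ℝ, 0 < b ∧ b ^ 2 = a ^ 2 - c ^ 2 := by
    have : 0 < a ^ 2 - c ^ 2 := by nlinarith
    exact ⟨_, Real.sqrt_pos.mpr this, Real.sq_sqrt this.le⟩
  have hba : b < a := by nlinarith
  have ha₀ : 0 < a := hc₀.trans hca
  have hcos : 0 < Real.cos α :=
    Real.cos_pos_of_mem_Ioo ⟨by linarith [hα.1, Real.pi_pos], hα.2⟩
  have hmem : ∀ t r : ℝ, t ^ 2 + r ^ 2 = 1 →
      (c + a * t) • u + (b * r) • w + F₁ ∈ Cone V d α := by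
    intro t r htr
    refine (hCE.ge ⟨?_, ?_⟩ : _ ∈ Cone V d α ∩ (Pl : Set (EuclideanSpace ℝ (Fin 3)))).1
    · exact AffineSubspace.vadd_mem_of_mem_direction
        (Pl.direction.add_mem (Pl.direction.smul_mem _ huPl) (Pl.direction.smul_mem _ hwPl)) hF₁
    · have h₁ := norm_ellipse_sub_focus hu hw huw (c := -c) ha₀
        (by rwa [abs_neg, abs_of_pos hc₀]) (by rw [hb]; ring) htr
      have h₂ := norm_ellipse_sub_focus hu hw huw (c := c) ha₀
        (by rwa [abs_of_pos hc₀]) hb htr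
      have e₁ : (c + a * t) • u + (b * r) • w + F₁ - F₁
          = (a * t - -c) • u + (b * r) • w := by module
      have e₂ : (c + a * t) • u + (b * r) • w + F₁ - F₂
          = (a * t - c) • u + (b * r) • w := by
        rw [← sub_add_cancel F₂ F₁, hF]
        module
      rw [dist_eq_norm, dist_eq_norm, e₁, e₂, h₁, h₂]
      ring
  have hX : ⟪F₁ + c • u - V, w⟫ = 0 := by
    refine minor_coeff_eq_zero_of_forall_ellipse hb₀ hba (pow_pos hcos 2)
      (S := ⟪F₁ + c • u - V, d⟫) (N := ‖F₁ + c • u - V‖ ^ 2) (D₁ := ⟪u, d⟫) (D₂ := ⟪w, d⟫)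
      (X₁ := ⟪F₁ + c • u - V, u⟫) fun t r htr => ?_
    have h : |⟪_, d⟫| = ‖_‖ * Real.cos α := hmem t r htr
    have e : (c + a * t) • u + (b * r) • w + F₁ - V
        = (F₁ + c • u - V) + (a * t) • u + (b * r) • w := by module
    rw [e] at h
    have hsq := congrArg (· ^ 2) h
    simp only [sq_abs, mul_pow, norm_sq_add_smul_add_smul hu hw huw] at hsq
    rw [inner_add_left, inner_add_left, real_inner_smul_left, real_inner_smul_left] at hsq
    linear_combination hsq
  have hVw : ⟪w, V - F₁⟫ = 0 := by
    rw [inner_sub_left, inner_add_left, real_inner_smul_left, huw] at hX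
    rw [inner_sub_right, real_inner_comm, real_inner_comm F₁]
    linarith
  rw [AffineSubspace.mem_mk', vsub_eq_sub, ← B.sum_repr' (V - F₁), Fin.sum_univ_three, hB₀, hB₁,
    hB₂, hVw, zero_smul, add_zero]
  refine Submodule.add_mem _ (Submodule.smul_mem _ _ ?_)
    (Submodule.smul_mem _ _ (Submodule.subset_span (by simp)))
  rw [hu_def]
  exact Submodule.smul_mem _ _ (Submodule.subset_span (by simp))
end

section
/- Let E be an ellipse in a plane Π of ℝ³ with distinct foci F₁, F₂, semi-major axis a, eccentricity e, and major-axis endpoints A and P, and let C be a cone with vertex V such that C ∩ Π = E. Then |dist V A − dist V P| = 2ea = dist F₁ F₂; that is, V lies on the hyperbola in the plane Π′ (the plane through F₁, F₂ perpendicular to Π) having foci A and P and vertices F₁ and F₂. -/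
open scoped RealInnerProductSpace

/-- A unit vector of a plane has a unit vector of that plane orthogonal to it. -/
theorem exists_unit_orthogonal_mem {W : Type*} [NormedAddCommGroup W] [InnerProductSpace ℝ W]
    (S : Submodule ℝ W) (hS : Module.finrank ℝ S = 2) {u : W} (huS : u ∈ S) (hu : ‖u‖ = 1) :
    ∃ w ∈ S, ‖w‖ = 1 ∧ ⟪u, w⟫ = 0 := by
  have : Fact (Module.finrank ℝ S = 1 + 1) := ⟨hS⟩
  have hu0 : (⟨u, huS⟩ : S) ≠ 0 := by
    intro h
    have : u = 0 := congrArg Subtype.val h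
    simp [this] at hu
  have h1 : Module.finrank ℝ (ℝ ∙ (⟨u, huS⟩ : S))ᗮ = 1 :=
    Submodule.finrank_orthogonal_span_singleton hu0
  have hpos : 0 < Module.finrank ℝ (ℝ ∙ (⟨u, huS⟩ : S))ᗮ := by lia
  have := Module.finite_of_finrank_pos hpos
  obtain ⟨⟨w, hw⟩, hw0⟩ := Module.finrank_pos_iff_exists_ne_zero.mp hpos
  have hw' : (w : W) ≠ 0 := by
    simpa using hw0
  have hin : ⟪u, (w : W)⟫ = 0 := by
    simpa using Submodule.mem_orthogonal_singleton_iff_inner_right.mp hw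
  refine ⟨‖(w : W)‖⁻¹ • (w : W), S.smul_mem _ w.2, norm_smul_inv_norm hw', ?_⟩
  rw [inner_smul_right, hin, mul_zero]

/-- The focal distance of a point of an ellipse, in coordinates centred at the centre. -/
theorem norm_focal_radius {W : Type*} [NormedAddCommGroup W] [InnerProductSpace ℝ W]
    {u w : W} (hu : ‖u‖ = 1) (hw : ‖w‖ = 1) (huw : ⟪u, w⟫ = 0) {a b c X Y : ℝ}
    (hca : |c| < a) (hb : b ^ 2 = a ^ 2 - c ^ 2) (hXY : X ^ 2 + Y ^ 2 = 1) :
    ‖(a * X + c) • u + (b * Y) • w‖ = a + c * X := by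
  have hX : |X| ≤ 1 := abs_le_one_iff_mul_self_le_one.mpr (by nlinarith [sq_nonneg Y])
  have hcX : |c * X| ≤ |c| := by
    rw [abs_mul]; exact mul_le_of_le_one_right (abs_nonneg _) hX
  have h0 : 0 ≤ a + c * X := by linarith [neg_abs_le (c * X)]
  rw [← sq_eq_sq₀ (norm_nonneg _) h0, norm_add_sq_real, norm_smul, norm_smul, hu, hw,
    inner_smul_left, inner_smul_right, huw]
  simp only [mul_one, Real.norm_eq_abs, sq_abs, mul_zero, add_zero, mul_pow, hb]
  linear_combination (a ^ 2 - c ^ 2) * hXY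

theorem abs_abs_add_sub_abs_sub {x y : ℝ} (h : |x| ≤ |y|) :
    |(|y + x| - |y - x|)| = 2 * |x| := by
  rcases abs_cases y with ⟨hy, _⟩ | ⟨hy, _⟩
  · rw [hy] at h
    obtain ⟨h1, h2⟩ := abs_le.mp h
    rw [abs_of_nonneg (by linarith : 0 ≤ y + x), abs_of_nonneg (by linarith : 0 ≤ y - x),
      show y + x - (y - x) = 2 * x by ring, abs_mul, abs_two]
  · rw [hy] at h
    obtain ⟨h1, h2⟩ := abs_le.mp h
    rw [abs_of_nonpos (by linarith : y + x ≤ 0), abs_of_nonpos (by linarith : y - x ≤ 0),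
      show -(y + x) - -(y - x) = -(2 * x) by ring, abs_neg, abs_mul, abs_two]

/-- If a cone with vertex at the origin and axis `d` contains the ellipse
centred at `N` with axes along the orthonormal vectors `u`, `w` and semi-axes `b < a`, then the
distances from the origin to the ends of the major axis differ by the focal distance. -/
theorem abs_norm_sub_norm_of_ellipse_subset_cone
    {W : Type*} [NormedAddCommGroup W] [InnerProductSpace ℝ W]
    {u w N d : W} (hu : ‖u‖ = 1) (hw : ‖w‖ = 1) (huw : ⟪u, w⟫ = 0) {a b c k : ℝ}
    (hk : 0 < k) (hb : 0 < b) (hc : 0 < c) (ha : 0 < a) (habc : b ^ 2 = a ^ 2 - c ^ 2)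
    (h : ∀ X Y : ℝ, X ^ 2 + Y ^ 2 = 1 →
      |⟪N + (a * X) • u + (b * Y) • w, d⟫| = ‖N + (a * X) • u + (b * Y) • w‖ * k) :
    |‖N + a • u‖ - ‖N - a • u‖| = 2 * c := by
  set p := ⟪u, d⟫ with hp
  set q := ⟪w, d⟫ with hq
  set m := ⟪N, d⟫ with hm
  set s := ⟪N, u⟫ with hs
  set t := ⟪N, w⟫ with ht
  have key : ∀ X Y : ℝ, X ^ 2 + Y ^ 2 = 1 → (m + a * X * p + b * Y * q) ^ 2 =
      k ^ 2 * (‖N‖ ^ 2 + 2 * (a * X) * s + 2 * (b * Y) * t + (a * X) ^ 2 + (b * Y) ^ 2) := by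
    intro X Y hXY
    have h2 := congrArg (· ^ 2) (h X Y hXY)
    simp only [sq_abs, mul_pow] at h2
    rw [norm_add_sq_real, norm_add_sq_real, inner_add_left, inner_add_left, inner_add_left,
      inner_smul_left, inner_smul_left, inner_smul_right, inner_smul_right, inner_smul_left,
      inner_smul_right, huw, norm_smul, norm_smul, hu, hw] at h2
    simp only [mul_one, Real.norm_eq_abs, sq_abs, conj_trivial] at h2
    rw [← hp, ← hq, ← hm, ← hs, ← ht] at h2
    linear_combination h2
  have k1 := key 1 0 (by norm_num)
  have k2 := key (-1) 0 (by norm_num)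
  have k3 := key 0 1 (by norm_num)
  have k4 := key 0 (-1) (by norm_num)
  have k5 := key (3 / 5) (4 / 5) (by norm_num)
  have k6 := key (3 / 5) (-(4 / 5)) (by norm_num)
  have e1 : m * p = k ^ 2 * s := by
    apply mul_left_cancel₀ ha.ne'
    linear_combination (k1 - k2) / 4
  have e2 : m * q = k ^ 2 * t := by
    apply mul_left_cancel₀ hb.ne'
    linear_combination (k3 - k4) / 4
  have e3 : p * q = 0 := by
    apply mul_left_cancel₀ (mul_pos ha hb).ne'
    linear_combination (k5 - k6) * (25 / 48) - (5 / 3) * b * e2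
  have e4 : a ^ 2 * (p ^ 2 - k ^ 2) = k ^ 2 * ‖N‖ ^ 2 - m ^ 2 := by
    linear_combination (k1 + k2) / 2
  have e5 : b ^ 2 * (q ^ 2 - k ^ 2) = k ^ 2 * ‖N‖ ^ 2 - m ^ 2 := by
    linear_combination (k3 + k4) / 2
  have hp0 : p ≠ 0 := by
    intro h0
    rw [h0] at e4
    nlinarith [sq_nonneg (b * q), mul_pos (pow_pos hk 2) (pow_pos hc 2)]
  have hq0 : q = 0 := (mul_eq_zero.mp e3).resolve_left hp0
  rw [hq0] at e5
  have hpc : (a * p) ^ 2 = (k * c) ^ 2 := by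
    linear_combination e4 - e5 - k ^ 2 * habc
  have hsN : s ^ 2 ≤ ‖N‖ ^ 2 := by
    rw [sq_le_sq, abs_norm]
    simpa [hu] using abs_real_inner_le_norm N u
  have hm2 : m ^ 2 = k ^ 2 * (‖N‖ ^ 2 + b ^ 2) := by linear_combination e5
  have hs2 : (‖N‖ ^ 2 + b ^ 2) * c ^ 2 = a ^ 2 * s ^ 2 := by
    apply mul_left_cancel₀ (pow_pos hk 4).ne'
    linear_combination (-(k * c) ^ 2) * hm2 - m ^ 2 * hpc
      + a ^ 2 * (m * p + k ^ 2 * s) * e1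
  have hcs : c ^ 2 ≤ s ^ 2 := by
    have : b ^ 2 * c ^ 2 ≤ b ^ 2 * s ^ 2 := by
      linear_combination c ^ 2 * hsN + hs2 - s ^ 2 * habc
    exact le_of_mul_le_mul_left this (pow_pos hb 2)
  have hmp : (a * p) ^ 2 ≤ m ^ 2 := by
    rw [hpc, hm2, mul_pow]
    exact mul_le_mul_of_nonneg_left (by linarith [sq_nonneg b]) (sq_nonneg k)
  have n1 := h 1 0 (by norm_num)
  have n2 := h (-1) 0 (by norm_num)
  simp only [mul_one, mul_zero, zero_smul, add_zero, mul_neg, neg_smul, ← sub_eq_add_neg,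
    inner_add_left, inner_sub_left, inner_smul_left, conj_trivial] at n1 n2
  rw [← hm, ← hp] at n1 n2
  have hap : |a * p| = k * c := by
    rw [← abs_of_pos (mul_pos hk hc)]; exact (sq_eq_sq_iff_abs_eq_abs _ _).mp hpc
  apply mul_right_cancel₀ hk.ne'
  rw [← abs_of_pos hk, ← abs_mul, abs_of_pos hk, sub_mul, ← n1, ← n2]
  rw [abs_abs_add_sub_abs_sub (sq_le_sq.mp hmp), hap]
  ring

/-- The major-axis endpoints of an ellipse lie at distance `a` from its centre. -/
theorem exists_eq_of_mem_affineSpan_foci {W : Type*} [NormedAddCommGroup W]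
    [InnerProductSpace ℝ W] {O u : W} (hu : ‖u‖ = 1) {a c : ℝ} (hc : 0 < c) (hca : c < a) {Q : W}
    (hQ : Q ∈ affineSpan ℝ {O - c • u, O + c • u})
    (hd : dist Q (O - c • u) + dist Q (O + c • u) = 2 * a) :
    Q = O + a • u ∨ Q = O - a • u := by
  rw [← vsub_vadd Q (O - c • u), vadd_left_mem_affineSpan_pair] at hQ
  obtain ⟨τ, hτ⟩ := hQ
  have hx : Q = O + (c * (2 * τ - 1)) • u := by
    rw [← vsub_vadd Q (O - c • u), ← hτ, vsub_eq_sub, vadd_eq_add]; module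
  rw [hx] at hd ⊢
  generalize c * (2 * τ - 1) = x at hd ⊢
  rw [dist_eq_norm, dist_eq_norm, show O + x • u - (O - c • u) = (x + c) • u by module,
    show O + x • u - (O + c • u) = (x - c) • u by module, norm_smul, norm_smul, hu, mul_one,
    mul_one, Real.norm_eq_abs, Real.norm_eq_abs] at hd
  have : x = a ∨ x = -a := by
    rcases abs_cases (x + c) with h1 | h1 <;> rcases abs_cases (x - c) with h2 | h2 <;>
      first
      | (left; linarith)
      | (right; linarith)
  rcases this with rfl | rfl
  · exact Or.inl rfl
  · right; module

/-- The vertex `V` of any cone belonging to an ellipse `E` with major-axis endpoints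
`A`, `P` satisfies `|dist V A − dist V P| = 2ea = dist F₁ F₂`; that is, `V` lies on the
hyperbola with foci `A`, `P` and vertices `F₁`, `F₂`. -/
theorem cone_vertex_on_hyperbola
    (Pl : AffineSubspace ℝ (EuclideanSpace ℝ (Fin 3)))
    (hPl : Module.finrank ℝ Pl.direction = 2)
    (F₁ F₂ : EuclideanSpace ℝ (Fin 3)) (hF₁ : F₁ ∈ Pl) (hF₂ : F₂ ∈ Pl) (hFne : F₁ ≠ F₂)
    (a : ℝ) (ha : dist F₁ F₂ < 2 * a)
    (E : Set (EuclideanSpace ℝ (Fin 3)))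
    (hE : E = {P | P ∈ Pl ∧ dist P F₁ + dist P F₂ = 2 * a})
    (e : ℝ) (he : e = dist F₁ F₂ / (2 * a))
    (A P : EuclideanSpace ℝ (Fin 3))
    (hA : A ∈ E) (hAline : A ∈ affineSpan ℝ {F₁, F₂})
    (hP : P ∈ E) (hPline : P ∈ affineSpan ℝ {F₁, F₂}) (hAP : A ≠ P)
    (V d : EuclideanSpace ℝ (Fin 3)) (hd : ‖d‖ = 1)
    (α : ℝ) (hα : α ∈ Set.Ioo 0 (Real.pi / 2))
    (C : Set (EuclideanSpace ℝ (Fin 3))) (hC : C = Cone V d α)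
    (hCE : C ∩ (Pl : Set (EuclideanSpace ℝ (Fin 3))) = E) :
    |dist V A - dist V P| = 2 * e * a ∧ 2 * e * a = dist F₁ F₂ := by
  obtain ⟨c, hcdef⟩ : ∃ c, c = dist F₁ F₂ / 2 := ⟨_, rfl⟩
  have hc : 0 < c := by rw [hcdef]; exact half_pos (dist_pos.mpr hFne)
  have hca : c < a := by linarith
  have ha0 : 0 < a := hc.trans hca
  have hdist : 2 * e * a = dist F₁ F₂ := by rw [he]; field_simp
  refine ⟨?_, hdist⟩
  have hnorm : ‖F₂ - F₁‖ = 2 * c := by rw [hcdef, ← dist_eq_norm, dist_comm]; ring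
  obtain ⟨u, hudef⟩ : ∃ u, u = (2 * c)⁻¹ • (F₂ - F₁) := ⟨_, rfl⟩
  obtain ⟨O, hO⟩ : ∃ O, O = F₁ + c • u := ⟨_, rfl⟩
  have hF : F₂ - F₁ = (2 * c) • u := by
    rw [hudef, smul_smul, mul_inv_cancel₀ (by positivity), one_smul]
  have hu : ‖u‖ = 1 := by
    rw [hudef, norm_smul, hnorm, Real.norm_of_nonneg (by positivity)]
    field_simp
  have hF1 : F₁ = O - c • u := by rw [hO]; module
  have hF2 : F₂ = O + c • u := by
    rw [eq_add_of_sub_eq hF, hO]; module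
  have huS : u ∈ Pl.direction := by
    rw [hudef]
    exact Pl.direction.smul_mem _ (AffineSubspace.vsub_mem_direction hF₂ hF₁)
  obtain ⟨w, hwS, hw, huw⟩ := exists_unit_orthogonal_mem Pl.direction hPl huS hu
  obtain ⟨b, hbdef⟩ : ∃ b, b = √(a ^ 2 - c ^ 2) := ⟨_, rfl⟩
  have hpos : 0 < a ^ 2 - c ^ 2 := by nlinarith
  have hb : 0 < b := hbdef ▸ Real.sqrt_pos.mpr hpos
  have habc : b ^ 2 = a ^ 2 - c ^ 2 := by rw [hbdef, Real.sq_sqrt hpos.le]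
  have hcone : ∀ X Y : ℝ, X ^ 2 + Y ^ 2 = 1 →
      |⟪(O - V) + (a * X) • u + (b * Y) • w, d⟫| =
        ‖(O - V) + (a * X) • u + (b * Y) • w‖ * Real.cos α := by
    intro X Y hXY
    have hmem : O + (a * X) • u + (b * Y) • w ∈ C := by
      refine (hCE.symm ▸ ?_ : O + (a * X) • u + (b * Y) • w ∈ C ∩ (Pl : Set _)).1
      rw [hE]
      constructor
      · have := AffineSubspace.vadd_mem_of_mem_direction (Pl.direction.add_mem
          (Pl.direction.smul_mem (a * X + c) huS) (Pl.direction.smul_mem (b * Y) hwS)) hF₁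
        convert this using 1
        rw [hO, vadd_eq_add]; module
      · have h1 := norm_focal_radius hu hw huw (by rwa [abs_of_pos hc]) habc hXY
        have h2 := norm_focal_radius (c := -c) hu hw huw (by rwa [abs_neg, abs_of_pos hc])
          (by rw [habc]; ring) hXY
        rw [hF1, hF2, dist_eq_norm, dist_eq_norm,
          show O + (a * X) • u + (b * Y) • w - (O - c • u)
            = (a * X + c) • u + (b * Y) • w by module,
          show O + (a * X) • u + (b * Y) • w - (O + c • u)
            = (a * X + -c) • u + (b * Y) • w by module, h1, h2]
        ring
    rw [hC] at hmem
    rw [show (O - V) + (a * X) • u + (b * Y) • w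
      = O + (a * X) • u + (b * Y) • w - V by module]
    exact hmem
  have hk : 0 < Real.cos α :=
    Real.cos_pos_of_mem_Ioo ⟨by linarith [hα.1, Real.pi_pos], hα.2⟩
  have main := abs_norm_sub_norm_of_ellipse_subset_cone hu hw huw hk hb hc ha0 habc hcone
  rw [show O - V + a • u = O + a • u - V by module,
    show O - V - a • u = O - a • u - V by module, ← dist_eq_norm, ← dist_eq_norm,
    dist_comm, dist_comm (O - a • u)] at main
  rw [hE] at hA hP
  rw [hF1, hF2] at hAline hPline
  have hA2 := hA.2
  have hP2 := hP.2
  rw [hF1, hF2] at hA2 hP2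
  rw [hdist, show dist F₁ F₂ = 2 * c by rw [hcdef]; ring]
  rcases exists_eq_of_mem_affineSpan_foci hu hc hca hAline hA2 with h1 | h1 <;>
    rcases exists_eq_of_mem_affineSpan_foci hu hc hca hPline hP2 with h2 | h2
  · exact absurd (h1.trans h2.symm) hAP
  · rw [h1, h2, main]
  · rw [h1, h2, abs_sub_comm, main]
  · exact absurd (h1.trans h2.symm) hAP
end

section
/- Let E be an ellipse in a plane Π of ℝ³ with distinct foci F₁, F₂ and major-axis endpoints A and P, and let Π′ be the plane through F₁ and F₂ perpendicular to Π. Let V be a point of Π′ with V ∉ Π satisfying |dist V A − dist V P| = dist F₁ F₂ (i.e., V is a point of the hyperbola in Π′ with foci A, P and vertices F₁, F₂, other than its vertices). Then there exists a cone with vertex V that belongs to E, i.e. whose intersection with Π equals E. -/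
open scoped RealInnerProductSpace

/-- The bifocal equation of an ellipse with foci `±c • u`, in terms of the abscissa `p` and the
squared distance `r` to the center of a point whose distances to the foci are `s` and `t`. -/
lemma add_eq_two_mul_iff_of_focal_sq {a c p r s t : ℝ} (hc : 0 < c) (hca : c < a)
    (hpr : p ^ 2 ≤ r) (hs : 0 ≤ s) (ht : 0 ≤ t) (hs2 : s ^ 2 = r + 2 * c * p + c ^ 2)
    (ht2 : t ^ 2 = r - 2 * c * p + c ^ 2) :
    s + t = 2 * a ↔ a ^ 2 * r = a ^ 2 * (a ^ 2 - c ^ 2) + c ^ 2 * p ^ 2 := by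
  have ha : 0 < a := hc.trans hca
  constructor
  · intro h
    have h₁ : a * (s - t) = 2 * c * p := by linear_combination (hs2 - ht2 - (s - t) * h) / 2
    have h₂ : a * s = a ^ 2 + c * p := by linear_combination (h₁ + a * h) / 2
    linear_combination (a * s + a ^ 2 + c * p) * h₂ - a ^ 2 * hs2
  · intro h
    have hbc : 0 < a ^ 2 - c ^ 2 := by nlinarith
    have hp : p ^ 2 ≤ a ^ 2 := by
      refine le_of_mul_le_mul_left ?_ hbc
      nlinarith [mul_le_mul_of_nonneg_left hpr (sq_nonneg a)]
    obtain ⟨hp₁, hp₂⟩ := abs_le.mp (abs_le_of_sq_le_sq hp ha.le)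
    have h₁ : a * s = a ^ 2 + c * p := by
      refine (sq_eq_sq₀ (by positivity) (by nlinarith)).mp ?_
      linear_combination a ^ 2 * hs2 + h
    have h₂ : a * t = a ^ 2 - c * p := by
      refine (sq_eq_sq₀ (by positivity) (by nlinarith)).mp ?_
      linear_combination a ^ 2 * ht2 + h
    refine mul_left_cancel₀ ha.ne' ?_
    linear_combination h₁ + h₂

/-- The bifocal equation of a hyperbola with foci `±m` (where `m ^ 2 = a ^ 2`) and vertices `±c`
implies its Cartesian equation. -/
lemma hyperbola_equation_of_abs_sub_eq {a c m x z s t : ℝ} (hm : m ^ 2 = a ^ 2)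
    (hs2 : s ^ 2 = (x - m) ^ 2 + z ^ 2) (ht2 : t ^ 2 = (x + m) ^ 2 + z ^ 2)
    (h : |s - t| = 2 * c) :
    (a ^ 2 - c ^ 2) * x ^ 2 = c ^ 2 * (z ^ 2 + (a ^ 2 - c ^ 2)) := by
  have h₀ : (s - t) ^ 2 = (2 * c) ^ 2 := by rw [← h, sq_abs]
  have h₁ : (s - t) * s = 2 * (c ^ 2 - x * m) := by
    linear_combination (h₀ + hs2 - ht2) / 2
  have h₂ : c ^ 2 * s ^ 2 = (c ^ 2 - x * m) ^ 2 := by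
    linear_combination ((s - t) * s + 2 * (c ^ 2 - x * m)) * h₁ / 4 - s ^ 2 * h₀ / 4
  linear_combination c ^ 2 * hs2 - h₂ + (c ^ 2 - x ^ 2) * hm

section Coordinates

variable {W : Type*} [NormedAddCommGroup W] [InnerProductSpace ℝ W]

lemma norm_sub_smul_sq {u : W} (hu : ‖u‖ = 1) (y : W) (k : ℝ) :
    ‖y - k • u‖ ^ 2 = ‖y‖ ^ 2 - 2 * k * ⟪y, u⟫ + k ^ 2 := by
  rw [norm_sub_sq_real, inner_smul_right, norm_smul, hu, mul_one, Real.norm_eq_abs, sq_abs]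
  ring

lemma norm_smul_add_smul_sq {u n : W} (hu : ‖u‖ = 1) (hn : ‖n‖ = 1) (hun : ⟪u, n⟫ = 0)
    (x z : ℝ) : ‖x • u + z • n‖ ^ 2 = x ^ 2 + z ^ 2 := by
  rw [norm_add_sq_real, inner_smul_left, inner_smul_right, hun, norm_smul, norm_smul, hu, hn]
  simp

end Coordinates

/-- Squared form of membership in a cone whose axis is spanned by a vector `v` that need not be
normalized. -/
lemma mem_cone_smul_iff {V v Q : EuclideanSpace ℝ (Fin 3)} (hv : v ≠ 0) {k : ℝ} (hk : 0 ≤ k)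
    (hkv : k ≤ ‖v‖) :
    Q ∈ Cone V (‖v‖⁻¹ • v) (Real.arccos (k / ‖v‖)) ↔ ⟪Q - V, v⟫ ^ 2 = ‖Q - V‖ ^ 2 * k ^ 2 := by
  have hv' : 0 < ‖v‖ := norm_pos_iff.mpr hv
  have hcos : Real.cos (Real.arccos (k / ‖v‖)) = k / ‖v‖ :=
    Real.cos_arccos (by linarith [div_nonneg hk hv'.le]) ((div_le_one hv').mpr hkv)
  rw [Cone, Set.mem_ofPred_eq, hcos, inner_smul_right, abs_mul, abs_of_pos (inv_pos.mpr hv'),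
    inv_mul_eq_div, ← mul_div_assoc, div_left_inj' hv'.ne',
    ← sq_eq_sq₀ (abs_nonneg _) (mul_nonneg (norm_nonneg _) hk), sq_abs, mul_pow]

/-- Every point `V` of the hyperbola in the perpendicular plane `Π′` with foci at the
major-axis endpoints `A`, `P` and vertices `F₁`, `F₂`, other than points of `Π` itself,
is the vertex of a cone belonging to the ellipse `E`. -/
theorem hyperbola_point_is_cone_vertex
    (Pl : AffineSubspace ℝ (EuclideanSpace ℝ (Fin 3)))
    (hPl : Module.finrank ℝ Pl.direction = 2)
    (F₁ F₂ : EuclideanSpace ℝ (Fin 3)) (hF₁ : F₁ ∈ Pl) (hF₂ : F₂ ∈ Pl) (hFne : F₁ ≠ F₂)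
    (a : ℝ) (ha : dist F₁ F₂ < 2 * a)
    (E : Set (EuclideanSpace ℝ (Fin 3)))
    (hE : E = {P | P ∈ Pl ∧ dist P F₁ + dist P F₂ = 2 * a})
    (A P : EuclideanSpace ℝ (Fin 3))
    (hA : A ∈ E) (hAline : A ∈ affineSpan ℝ {F₁, F₂})
    (hP : P ∈ E) (hPline : P ∈ affineSpan ℝ {F₁, F₂}) (hAP : A ≠ P)
    (n : EuclideanSpace ℝ (Fin 3)) (hn : ‖n‖ = 1) (hnperp : n ∈ Pl.directionᗮ)
    (V : EuclideanSpace ℝ (Fin 3))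
    (hV : V ∈ AffineSubspace.mk' F₁ (Submodule.span ℝ {F₂ - F₁, n}))
    (hVout : V ∉ Pl)
    (hVhyp : |dist V A - dist V P| = dist F₁ F₂) :
    ∃ (d : EuclideanSpace ℝ (Fin 3)) (α : ℝ), ‖d‖ = 1 ∧ α ∈ Set.Ioo 0 (Real.pi / 2) ∧
      Cone V d α ∩ (Pl : Set (EuclideanSpace ℝ (Fin 3))) = E := by
  have hD : 0 < dist F₁ F₂ := dist_pos.mpr hFne
  obtain ⟨c, hcD⟩ : ∃ c, dist F₁ F₂ = 2 * c := ⟨dist F₁ F₂ / 2, by ring⟩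
  have hc : 0 < c := by linarith
  have hca : c < a := by linarith
  have ha₀ : 0 < a := hc.trans hca
  obtain ⟨u, hu⟩ : ∃ u, u = (2 * c)⁻¹ • (F₂ - F₁) := ⟨_, rfl⟩
  obtain ⟨O, hO⟩ : ∃ O, O = F₁ + c • u := ⟨_, rfl⟩
  have hFu : F₂ - F₁ = (2 * c) • u := by rw [hu, smul_inv_smul₀ (by positivity)]
  have hu₁ : ‖u‖ = 1 := by
    rw [hu, norm_smul, ← dist_eq_norm, dist_comm, hcD, norm_inv, Real.norm_of_nonneg (by positivity)]
    exact inv_mul_cancel₀ (by positivity)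
  have hF₁O : F₁ = O - c • u := by rw [hO]; abel
  have hF₂O : F₂ = O + c • u := by
    rw [hO, add_assoc, ← add_smul, ← two_mul, ← hFu]; abel
  have hudir : u ∈ Pl.direction :=
    hu ▸ Pl.direction.smul_mem _ (AffineSubspace.vsub_mem_direction hF₂ hF₁)
  have hOPl : O ∈ Pl := by
    rw [hO, add_comm]
    exact AffineSubspace.vadd_mem_of_mem_direction (Pl.direction.smul_mem _ hudir) hF₁
  have hun : ⟪u, n⟫ = 0 := (Submodule.mem_orthogonal _ _).mp hnperp u hudir
  have hbc : 0 < a ^ 2 - c ^ 2 := by nlinarith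
  have hEiff (Q) (hQ : Q ∈ Pl) : Q ∈ E ↔
      a ^ 2 * ‖Q - O‖ ^ 2 = a ^ 2 * (a ^ 2 - c ^ 2) + c ^ 2 * ⟪Q - O, u⟫ ^ 2 := by
    rw [hE, Set.mem_ofPred_eq, and_iff_right hQ, dist_eq_norm, dist_eq_norm]
    refine add_eq_two_mul_iff_of_focal_sq hc hca ?_ (norm_nonneg _) (norm_nonneg _) ?_ ?_
    · refine sq_le_sq.mpr ?_
      simpa [hu₁] using abs_real_inner_le_norm (Q - O) u
    · rw [show Q - F₁ = (Q - O) - (-c) • u by rw [hF₁O]; module, norm_sub_smul_sq hu₁]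
      ring
    · rw [show Q - F₂ = (Q - O) - c • u by rw [hF₂O]; module, norm_sub_smul_sq hu₁]
  have hEsub : E ⊆ Pl := by
    rw [hE]
    exact fun Q hQ => hQ.1
  have hvertex (Q) (hQ : Q ∈ E) (hQline : Q ∈ affineSpan ℝ {F₁, F₂}) :
      ∃ m : ℝ, Q = O + m • u ∧ m ^ 2 = a ^ 2 := by
    obtain ⟨τ, rfl⟩ := mem_affineSpan_pair_iff_exists_lineMap_eq.mp hQline
    have hτ : AffineMap.lineMap F₁ F₂ τ = O + (2 * c * τ - c) • u := by
      rw [AffineMap.lineMap_apply, vsub_eq_sub, vadd_eq_add, hFu, hF₁O]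
      module
    refine ⟨_, hτ, ?_⟩
    have h := (hEiff _ (hEsub hQ)).mp hQ
    rw [hτ, add_sub_cancel_left, norm_smul, hu₁, inner_smul_left, real_inner_self_eq_norm_sq, hu₁,
      mul_one, Real.norm_eq_abs, sq_abs] at h
    simp only [conj_trivial, one_pow, mul_one] at h
    refine mul_left_cancel₀ hbc.ne' ?_
    linear_combination h
  obtain ⟨m, hAm, hm⟩ := hvertex A hA hAline
  obtain ⟨m', hPm, hm'⟩ := hvertex P hP hPline
  obtain rfl : m' = -m := by
    refine (sq_eq_sq_iff_eq_or_eq_neg.mp (hm'.trans hm.symm)).resolve_left ?_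
    rintro rfl
    exact hAP (hAm.trans hPm.symm)
  obtain ⟨x, z, hVxz⟩ : ∃ x z : ℝ, V = O + (x • u + z • n) := by
    rw [AffineSubspace.mem_mk', Submodule.mem_span_pair] at hV
    obtain ⟨k, z, hkz⟩ := hV
    refine ⟨2 * c * k - c, z, ?_⟩
    rw [vsub_eq_sub, hFu, hF₁O, eq_sub_iff_add_eq] at hkz
    rw [← hkz]
    module
  have hz : z ≠ 0 := by
    rintro rfl
    refine hVout ?_
    rw [hVxz, zero_smul, add_zero, add_comm]
    exact AffineSubspace.vadd_mem_of_mem_direction (Pl.direction.smul_mem _ hudir) hOPl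
  have hhyp : (a ^ 2 - c ^ 2) * x ^ 2 = c ^ 2 * (z ^ 2 + (a ^ 2 - c ^ 2)) := by
    refine hyperbola_equation_of_abs_sub_eq hm ?_ ?_ (hVhyp.trans hcD)
    · rw [dist_eq_norm, ← norm_smul_add_smul_sq hu₁ hn hun, hVxz, hAm]
      congr 2
      module
    · rw [dist_eq_norm, ← norm_smul_add_smul_sq hu₁ hn hun, hVxz, hPm]
      congr 2
      module
  -- The axis is the tangent to the hyperbola at `V`.
  obtain ⟨v, hv⟩ : ∃ v, v = (z * c ^ 2) • u + (x * (a ^ 2 - c ^ 2)) • n := ⟨_, rfl⟩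
  have hv_sq : ‖v‖ ^ 2 = (|z| * c * a) ^ 2 + (c * (a ^ 2 - c ^ 2)) ^ 2 := by
    rw [hv, norm_smul_add_smul_sq hu₁ hn hun, mul_pow (|z| * c), mul_pow |z|, sq_abs]
    linear_combination (a ^ 2 - c ^ 2) * hhyp
  have hk : 0 < |z| * c * a := by positivity
  have hkv : |z| * c * a < ‖v‖ := by
    refine lt_of_pow_lt_pow_left₀ 2 (norm_nonneg _) ?_
    rw [hv_sq]
    exact lt_add_of_pos_right _ (by positivity)
  have hv₀ : 0 < ‖v‖ := hk.trans hkv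
  have hvne : v ≠ 0 := norm_pos_iff.mp hv₀
  refine ⟨‖v‖⁻¹ • v, Real.arccos (|z| * c * a / ‖v‖), norm_smul_inv_norm hvne,
    ⟨Real.arccos_pos.mpr ((div_lt_one hv₀).mpr hkv),
      Real.arccos_lt_pi_div_two.mpr (div_pos hk hv₀)⟩, ?_⟩
  rw [← Set.inter_eq_self_of_subset_left hEsub]
  ext Q
  refine and_congr_left fun hQ => ?_
  rw [mem_cone_smul_iff hvne hk.le hkv.le, hEiff Q hQ]
  have hQn : ⟪Q - O, n⟫ = 0 :=
    (Submodule.mem_orthogonal _ _).mp hnperp _ (AffineSubspace.vsub_mem_direction hQ hOPl)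
  have huu : ⟪u, u⟫ = 1 := by rw [real_inner_self_eq_norm_sq, hu₁, one_pow]
  have hnn : ⟪n, n⟫ = 1 := by rw [real_inner_self_eq_norm_sq, hn, one_pow]
  have hQV : Q - V = (Q - O) - (x • u + z • n) := by rw [hVxz]; abel
  have hinner : ⟪Q - V, v⟫ = z * (c ^ 2 * ⟪Q - O, u⟫ - a ^ 2 * x) := by
    rw [hQV, hv]
    simp only [inner_sub_left, inner_add_left, inner_add_right, real_inner_smul_left,
      real_inner_smul_right, huu, hnn, hun, real_inner_comm u n] at hQn ⊢
    linear_combination x * (a ^ 2 - c ^ 2) * hQn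
  have hnorm : ‖Q - V‖ ^ 2 = ‖Q - O‖ ^ 2 - 2 * x * ⟪Q - O, u⟫ + (x ^ 2 + z ^ 2) := by
    rw [hQV, norm_sub_sq_real, norm_smul_add_smul_sq hu₁ hn hun, inner_add_right,
      real_inner_smul_right, real_inner_smul_right, hQn]
    ring
  rw [hinner, hnorm, mul_pow (|z| * c), mul_pow |z|, sq_abs]
  have hzc : z ^ 2 * c ^ 2 ≠ 0 := by positivity
  refine ⟨fun h => mul_left_cancel₀ hzc ?_, fun h => ?_⟩
  · linear_combination -h + z ^ 2 * a ^ 2 * hhyp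
  · linear_combination -(z ^ 2 * c ^ 2) * h + z ^ 2 * a ^ 2 * hhyp
end

section
/- Let E be an ellipse in a plane Π of ℝ³ with distinct foci F₁, F₂ (so eccentricity 0 < e < 1). For each θ ∈ (0, π), the collection of subsets C of ℝ³ such that C is a cone of bloom θ and C ∩ Π = E has exactly four elements. -/
open scoped RealInnerProductSpace

theorem sum_dist_eq_iff {a e : ℝ} (ha : 0 < a) (he0 : 0 < e) (he1 : e < 1) (x y : ℝ) :
    √((x + e * a) ^ 2 + y ^ 2) + √((x - e * a) ^ 2 + y ^ 2) = 2 * a ↔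
      (1 - e ^ 2) * x ^ 2 + y ^ 2 = a ^ 2 * (1 - e ^ 2) := by
  have hsq : e ^ 2 < 1 := by nlinarith
  constructor
  · intro h
    have h₁ := Real.sq_sqrt (show 0 ≤ (x + e * a) ^ 2 + y ^ 2 by positivity)
    have h₂ := Real.sq_sqrt (show 0 ≤ (x - e * a) ^ 2 + y ^ 2 by positivity)
    set s := √((x + e * a) ^ 2 + y ^ 2)
    have ht : √((x - e * a) ^ 2 + y ^ 2) = 2 * a - s := by linarith
    rw [ht] at h₂
    have hs : s = a + e * x := by
      apply mul_left_cancel₀ ha.ne'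
      linarith
    rw [hs] at h₁
    linarith
  · intro h
    have hx : x ^ 2 ≤ a ^ 2 := by
      have : (1 - e ^ 2) * x ^ 2 ≤ (1 - e ^ 2) * a ^ 2 := by nlinarith [sq_nonneg y]
      exact le_of_mul_le_mul_left this (by linarith)
    obtain ⟨hx₁, hx₂⟩ := abs_le.mp (abs_le_of_sq_le_sq hx ha.le)
    rw [show (x + e * a) ^ 2 + y ^ 2 = (a + e * x) ^ 2 by linarith,
      show (x - e * a) ^ 2 + y ^ 2 = (a - e * x) ^ 2 by linarith,
      Real.sqrt_sq (by nlinarith), Real.sqrt_sq (by nlinarith)]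
    ring

/-- The quadratic form (in Cartesian coordinates) of a cone whose section by `z = 0` is the
ellipse with semi-major axis `a` and eccentricity `e`; here `k` is the squared cosine of the
half-angle, and `A`, `B` are the coefficients that depend on the position of the cone. -/
def coneForm (a e k A B x y z : ℝ) : ℝ :=
  k * (a ^ 2 * (1 - e ^ 2) - (1 - e ^ 2) * x ^ 2 - y ^ 2) + 2 * A * x * z + 2 * B * z +
    (1 - k - k * e ^ 2) * z ^ 2

theorem exists_coneForm_of_vanish {a e k : ℝ} (ha : 0 < a) (he0 : 0 < e) (he1 : e < 1)
    (hk0 : 0 < k) (hk1 : k < 1) {p q r l m n : ℝ} (hu : l ^ 2 + m ^ 2 + n ^ 2 = 1)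
    (h : ∀ x y, (1 - e ^ 2) * x ^ 2 + y ^ 2 = a ^ 2 * (1 - e ^ 2) →
      ((x - p) * l + (y - q) * m + (0 - r) * n) ^ 2 =
        k * ((x - p) ^ 2 + (y - q) ^ 2 + (0 - r) ^ 2)) :
    ∃ A B, A ^ 2 = k * e ^ 2 * (1 - k * e ^ 2) ∧ B ^ 2 = k * (1 - k) * a ^ 2 ∧
      ∀ x y z, ((x - p) * l + (y - q) * m + (z - r) * n) ^ 2 -
        k * ((x - p) ^ 2 + (y - q) ^ 2 + (z - r) ^ 2) = coneForm a e k A B x y z := by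
  have hsq : 0 < 1 - e ^ 2 := by nlinarith
  obtain ⟨b, hb, hb2⟩ : ∃ b, 0 < b ∧ b ^ 2 = a ^ 2 * (1 - e ^ 2) :=
    ⟨√(a ^ 2 * (1 - e ^ 2)), by positivity, Real.sq_sqrt (by positivity)⟩
  have h₁ := h a 0 (by ring)
  have h₂ := h (-a) 0 (by ring)
  have h₃ := h 0 b (by rw [hb2]; ring)
  have h₄ := h 0 (-b) (by rw [neg_sq, hb2]; ring)
  have h₅ := h (3 / 5 * a) (4 / 5 * b) (by rw [mul_pow, mul_pow, hb2]; ring)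
  obtain ⟨t, ht⟩ : ∃ t, t = -(p * l + q * m + r * n) := ⟨_, rfl⟩
  have hx : t * l + k * p = 0 := by
    apply mul_left_cancel₀ ha.ne'
    rw [ht]; linarith
  have hy : t * m + k * q = 0 := by
    apply mul_left_cancel₀ hb.ne'
    rw [ht]; linarith
  obtain ⟨z, hz⟩ : ∃ z, z = t ^ 2 - k * (p ^ 2 + q ^ 2 + r ^ 2) := ⟨_, rfl⟩
  have hxx : (l ^ 2 - k) * a ^ 2 + z = 0 := by rw [hz, ht]; linarith
  have hyy : (m ^ 2 - k) * b ^ 2 + z = 0 := by rw [hz, ht]; linarith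
  have hxy : l * m = 0 := by
    apply mul_left_cancel₀ (mul_pos ha hb).ne'
    have e₁ : l * m * (a * b) * (24 / 25) + ((l ^ 2 - k) * a ^ 2 + z) * (9 / 25) +
      ((m ^ 2 - k) * b ^ 2 + z) * (16 / 25) + (t * l + k * p) * (6 / 5 * a) +
      (t * m + k * q) * (8 / 5 * b) = 0 := by rw [hz, ht]; linarith
    rw [hxx, hyy, hx, hy] at e₁
    linarith
  have hm : m = 0 := by
    by_contra hm
    have hl : l = 0 := by simpa [hm] using hxy
    subst hl
    have : m ^ 2 * b ^ 2 = - (k * a ^ 2 * e ^ 2) := by rw [hb2] at *; linarith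
    have : 0 < k * a ^ 2 * e ^ 2 := by positivity
    nlinarith [mul_nonneg (sq_nonneg m) (sq_nonneg b)]
  subst hm
  have hq : q = 0 := by simpa [hk0.ne'] using hy
  subst hq
  have hzv : z = k * a ^ 2 * (1 - e ^ 2) := by rw [hb2] at hyy; linarith
  have hl : l ^ 2 = k * e ^ 2 := by
    apply mul_left_cancel₀ (pow_pos ha 2).ne'
    linarith
  have hn : n ^ 2 = 1 - k * e ^ 2 := by linarith
  have hn0 : 0 < 1 - k * e ^ 2 := by nlinarith
  have htr : t * (1 - e ^ 2) = - (r * n) := by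
    apply mul_left_cancel₀ hk0.ne'
    linear_combination k * ht + t * hl - l * hx
  have hk1' : 0 < 1 - k := by linarith
  have hB : n * (n * t + k * r) = t * (1 - k) := by
    linear_combination t * hn + k * htr
  have hT : t ^ 2 * (1 - k) = k * a ^ 2 * (1 - k * e ^ 2) := by
    have e₁ : k * z = k * t ^ 2 - (k * p) ^ 2 - k ^ 2 * r ^ 2 := by rw [hz]; ring
    have e₂ : k * p = - (t * l) := by linarith
    rw [e₂, hzv] at e₁
    have e₃ : n ^ 2 * r ^ 2 = t ^ 2 * (1 - e ^ 2) ^ 2 := by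
      linear_combination (r * n - t * (1 - e ^ 2)) * htr
    apply mul_left_cancel₀ (mul_pos hk0 hsq).ne'
    linear_combination (-n ^ 2) * e₁ + k ^ 2 * e₃ + n ^ 2 * t ^ 2 * hl +
      (k ^ 2 * a ^ 2 * (1 - e ^ 2) - k * t ^ 2 * (1 - e ^ 2)) * hn
  refine ⟨l * n, n * t + k * r, by rw [mul_pow, hl, hn], ?_, ?_⟩
  · apply mul_left_cancel₀ hn0.ne'
    rw [← hn]
    linear_combination (n * (n * t + k * r) + t * (1 - k)) * hB + (1 - k) * hT -
      k * (1 - k) * a ^ 2 * hn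
  · intro x y z'
    have hc : t ^ 2 - k * (p ^ 2 + r ^ 2) = k * a ^ 2 * (1 - e ^ 2) := by
      rw [← hzv, hz]; ring
    rw [show (x - p) * l + (y - 0) * 0 + (z' - r) * n = x * l + z' * n + t by rw [ht]; ring]
    unfold coneForm
    linear_combination hc + x ^ 2 * hl + 2 * x * hx + z' ^ 2 * hn

theorem exists_cone_of_coneForm {a e k : ℝ} (he0 : 0 < e) (he1 : e < 1)
    (hk0 : 0 < k) (hk1 : k < 1) {A B : ℝ} (hA : A ^ 2 = k * e ^ 2 * (1 - k * e ^ 2))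
    (hB : B ^ 2 = k * (1 - k) * a ^ 2) :
    ∃ p q r l m n : ℝ, l ^ 2 + m ^ 2 + n ^ 2 = 1 ∧
      ∀ x y z, ((x - p) * l + (y - q) * m + (z - r) * n) ^ 2 -
        k * ((x - p) ^ 2 + (y - q) ^ 2 + (z - r) ^ 2) = coneForm a e k A B x y z := by
  have hn0 : 0 < 1 - k * e ^ 2 := by nlinarith
  have hk1' : 0 < 1 - k := by linarith
  obtain ⟨l, hl0, hl⟩ : ∃ l, 0 < l ∧ l ^ 2 = k * e ^ 2 :=
    ⟨√(k * e ^ 2), by positivity, Real.sq_sqrt (by positivity)⟩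
  obtain ⟨n, hn⟩ : ∃ n, A = l * n := ⟨A / l, by field_simp⟩
  have hn2 : n ^ 2 = 1 - k * e ^ 2 := by
    apply mul_left_cancel₀ (pow_pos hl0 2).ne'
    rw [← mul_pow, ← hn, hA, hl]
  have hnn : n ≠ 0 := by rintro rfl; simp at hn2; linarith
  obtain ⟨t, ht⟩ : ∃ t, t * (1 - k) = B * n := ⟨B * n / (1 - k), by field_simp⟩
  obtain ⟨p, hp⟩ : ∃ p, k * p = - (t * l) := ⟨- (t * l) / k, by field_simp⟩
  obtain ⟨r, hr⟩ : ∃ r, n * r = - (t * (1 - e ^ 2)) := ⟨- (t * (1 - e ^ 2)) / n, by field_simp⟩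
  have hpt : t = - (p * l + r * n) := by
    apply mul_left_cancel₀ hk0.ne'
    linear_combination k * hr + l * hp - t * hl
  have hBt : n * t + k * r = B := by
    apply mul_left_cancel₀ hnn
    linear_combination t * hn2 + k * hr + ht
  have ht2 : t ^ 2 * (1 - k) = k * a ^ 2 * (1 - k * e ^ 2) := by
    apply mul_left_cancel₀ hk1'.ne'
    linear_combination (t * (1 - k) + B * n) * ht + n ^ 2 * hB + k * (1 - k) * a ^ 2 * hn2
  have hc : t ^ 2 - k * (p ^ 2 + r ^ 2) = k * a ^ 2 * (1 - e ^ 2) := by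
    have e₃ : n ^ 2 * r ^ 2 = t ^ 2 * (1 - e ^ 2) ^ 2 := by
      linear_combination (r * n - t * (1 - e ^ 2)) * hr
    apply mul_left_cancel₀ (mul_pos hk0 hn0).ne'
    rw [← hn2]
    linear_combination (- n ^ 2 * (k * p - t * l)) * hp - k ^ 2 * e₃ - n ^ 2 * t ^ 2 * hl +
      (k * t ^ 2 * (1 - e ^ 2) - k ^ 2 * a ^ 2 * (1 - e ^ 2)) * hn2 + k * (1 - e ^ 2) * ht2
  refine ⟨p, 0, r, l, 0, n, by rw [hl, hn2]; ring, fun x y z => ?_⟩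
  rw [show (x - p) * l + (y - 0) * 0 + (z - r) * n = x * l + z * n + t by rw [hpt]; ring]
  unfold coneForm
  rw [hn]
  linear_combination hc + x ^ 2 * hl + 2 * x * hp + z ^ 2 * hn2 + 2 * z * hBt

theorem coneForm_injective {a e k : ℝ} (ha : 0 < a) (he0 : 0 < e) (he1 : e < 1)
    (hk0 : 0 < k) {A B A' B' : ℝ}
    (h : ∀ x y z, coneForm a e k A B x y z = 0 → coneForm a e k A' B' x y z = 0) :
    A = A' ∧ B = B' := by
  have hsq : 0 < 1 - e ^ 2 := by nlinarith
  have key : ∀ x z, 0 < coneForm a e k A B x 0 z →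
      A * x * z + B * z = A' * x * z + B' * z := by
    intro x z hpos
    have hy : k * √(coneForm a e k A B x 0 z / k) ^ 2 = coneForm a e k A B x 0 z := by
      rw [Real.sq_sqrt (by positivity)]; field_simp
    generalize √(coneForm a e k A B x 0 z / k) = y at hy
    have h₁ : coneForm a e k A B x y z = 0 := by
      unfold coneForm at hy ⊢; linarith
    have h₂ := h x y z h₁
    unfold coneForm at h₁ h₂
    linarith
  have hev (s : ℝ) : ∀ᶠ ε in nhds (0 : ℝ), 0 < coneForm a e k A B (s * ε) 0 ε := by
    have hcont : Continuous fun ε => coneForm a e k A B (s * ε) 0 ε := by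
      unfold coneForm; fun_prop
    refine hcont.continuousAt.eventually (lt_mem_nhds ?_)
    simp only [coneForm]
    ring_nf
    nlinarith [mul_pos (mul_pos hk0 (pow_pos ha 2)) hsq]
  obtain ⟨ε, ⟨h₀, h₁⟩, hε⟩ := (((hev 0).and (hev 1)).filter_mono nhdsWithin_le_nhds |>.and
    (self_mem_nhdsWithin : Set.Ioi (0 : ℝ) ∈ nhdsWithin 0 (Set.Ioi 0))).exists
  have hε' : ε ≠ 0 := (Set.mem_Ioi.mp hε).ne'
  have hB : B = B' := by
    apply mul_right_cancel₀ hε'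
    linarith [key _ _ h₀]
  refine ⟨?_, hB⟩
  apply mul_right_cancel₀ (mul_ne_zero hε' hε')
  have := key _ _ h₁
  rw [hB] at this
  linarith

theorem exists_orthonormalBasis_of_finrank_direction_eq_two
    {Pl : AffineSubspace ℝ (EuclideanSpace ℝ (Fin 3))} (hPl : Module.finrank ℝ Pl.direction = 2)
    {F M : EuclideanSpace ℝ (Fin 3)} (hF : F ∈ Pl) (hM : M ∈ Pl) (hFM : F ≠ M) :
    ∃ o : OrthonormalBasis (Fin 3) ℝ (EuclideanSpace ℝ (Fin 3)),
      F - M = ‖F - M‖ • o 0 ∧ ∀ P, P ∈ Pl ↔ ⟪o 2, P - M⟫ = 0 := by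
  have hne : ‖F - M‖ ≠ 0 := norm_ne_zero_iff.mpr (sub_ne_zero.mpr hFM)
  have hfr : Module.finrank ℝ Pl.directionᗮ = 1 :=
    Submodule.finrank_add_finrank_orthogonal' (by simp [hPl])
  obtain ⟨w, hw, hw0⟩ := Submodule.exists_mem_ne_zero_of_ne_bot
    (Submodule.one_le_finrank_iff.mp hfr.ge)
  have hspan : (ℝ ∙ w) = Pl.directionᗮ := by
    apply Submodule.eq_of_le_of_finrank_eq
    · rwa [Submodule.span_singleton_le_iff_mem]
    · rw [finrank_span_singleton hw0, hfr]
  have hdir (v : EuclideanSpace ℝ (Fin 3)) : v ∈ Pl.direction ↔ ⟪w, v⟫ = 0 := by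
    rw [← Submodule.orthogonal_orthogonal Pl.direction, ← hspan,
      Submodule.mem_orthogonal_singleton_iff_inner_right]
  have hwn : ‖w‖ ≠ 0 := norm_ne_zero_iff.mpr hw0
  have hFd : ⟪w, F - M⟫ = 0 := (hdir _).mp (AffineSubspace.vsub_mem_direction hF hM)
  have hon : Orthonormal ℝ (({0, 2} : Set (Fin 3)).domRestrict
      ![‖F - M‖⁻¹ • (F - M), 0, ‖w‖⁻¹ • w]) := by
    constructor
    · rintro ⟨i, rfl | rfl⟩
      · simp [norm_smul, hne]
      · simp [norm_smul, hwn]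
    · rintro ⟨i, rfl | rfl⟩ ⟨j, rfl | rfl⟩ hij
      · exact absurd rfl hij
      · simp [inner_smul_left, inner_smul_right, real_inner_comm, hFd]
      · simp [inner_smul_left, inner_smul_right, hFd]
      · exact absurd rfl hij
  obtain ⟨o, ho⟩ := hon.exists_orthonormalBasis_extension_of_card_eq (by simp)
  have ho₀ : o 0 = ‖F - M‖⁻¹ • (F - M) := ho 0 (by simp)
  have ho₂ : o 2 = ‖w‖⁻¹ • w := ho 2 (by simp)
  refine ⟨o, by rw [ho₀, smul_smul, mul_inv_cancel₀ hne, one_smul], fun P => ?_⟩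
  rw [ho₂, inner_smul_left, ← AffineSubspace.vsub_right_mem_direction_iff_mem hM, vsub_eq_sub, hdir]
  simp [hw0]

/-- The vector with coordinates `x`, `y`, `z` in the orthonormal basis `o`. -/
noncomputable def frameVector (o : OrthonormalBasis (Fin 3) ℝ (EuclideanSpace ℝ (Fin 3))) (x y z : ℝ) :
    EuclideanSpace ℝ (Fin 3) :=
  x • o 0 + y • o 1 + z • o 2

section frameVector

variable (o : OrthonormalBasis (Fin 3) ℝ (EuclideanSpace ℝ (Fin 3)))

theorem frameVector_sub (x y z x' y' z' : ℝ) :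
    frameVector o x y z - frameVector o x' y' z' = frameVector o (x - x') (y - y') (z - z') := by
  unfold frameVector
  module

theorem inner_frameVector (x y z x' y' z' : ℝ) :
    ⟪frameVector o x y z, frameVector o x' y' z'⟫ = x * x' + y * y' + z * z' := by
  have h := o.inner_eq_ite
  simp [frameVector, inner_add_left, inner_add_right, inner_smul_left, inner_smul_right, h]
  ring

theorem norm_frameVector (x y z : ℝ) :
    ‖frameVector o x y z‖ = √(x ^ 2 + y ^ 2 + z ^ 2) := by
  rw [norm_eq_sqrt_real_inner, inner_frameVector]
  ring_nf

theorem exists_eq_frameVector (v : EuclideanSpace ℝ (Fin 3)) :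
    ∃ x y z, v = frameVector o x y z :=
  ⟨_, _, _, by rw [frameVector, ← Fin.sum_univ_three (fun i => ⟪o i, v⟫ • o i), o.sum_repr']⟩

theorem exists_eq_add_frameVector (M P : EuclideanSpace ℝ (Fin 3)) :
    ∃ x y z, P = M + frameVector o x y z := by
  obtain ⟨x, y, z, h⟩ := exists_eq_frameVector o (P - M)
  exact ⟨x, y, z, by rw [← h]; abel⟩

theorem mem_Cone_frameVector_iff (M : EuclideanSpace ℝ (Fin 3)) {α : ℝ} (hα : 0 ≤ Real.cos α)
    (x y z p q r l m n : ℝ) :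
    M + frameVector o x y z ∈ Cone (M + frameVector o p q r) (frameVector o l m n) α ↔
      ((x - p) * l + (y - q) * m + (z - r) * n) ^ 2 -
        Real.cos α ^ 2 * ((x - p) ^ 2 + (y - q) ^ 2 + (z - r) ^ 2) = 0 := by
  rw [Cone, Set.mem_ofPred_eq, add_sub_add_left_eq_sub, frameVector_sub, inner_frameVector,
    norm_frameVector, ← sq_eq_sq₀ (abs_nonneg _) (by positivity), sq_abs, mul_pow,
    Real.sq_sqrt (by positivity), sub_eq_zero, mul_comm (Real.cos α ^ 2)]

/-- The quadric with equation `coneForm a e k A B = 0` in the Cartesian frame with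
origin `M` and basis `o`. -/
def coneQuadric (M : EuclideanSpace ℝ (Fin 3)) (a e k A B : ℝ) :
    Set (EuclideanSpace ℝ (Fin 3)) :=
  {P | ∃ x y z, P = M + frameVector o x y z ∧ coneForm a e k A B x y z = 0}

theorem frameVector_inj {x y z x' y' z' : ℝ} (h : frameVector o x y z = frameVector o x' y' z') :
    x = x' ∧ y = y' ∧ z = z' := by
  have h₀ := congrArg (⟪·, frameVector o 1 0 0⟫) h
  have h₁ := congrArg (⟪·, frameVector o 0 1 0⟫) h
  have h₂ := congrArg (⟪·, frameVector o 0 0 1⟫) h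
  simp only [inner_frameVector] at h₀ h₁ h₂
  exact ⟨by linarith, by linarith, by linarith⟩

theorem mem_coneQuadric_iff (M : EuclideanSpace ℝ (Fin 3)) (a e k A B x y z : ℝ) :
    M + frameVector o x y z ∈ coneQuadric o M a e k A B ↔ coneForm a e k A B x y z = 0 := by
  constructor
  · rintro ⟨x', y', z', h, h'⟩
    obtain ⟨rfl, rfl, rfl⟩ := frameVector_inj o (add_left_cancel h)
    exact h'
  · exact fun h => ⟨x, y, z, rfl, h⟩

theorem coneQuadric_inj (M : EuclideanSpace ℝ (Fin 3)) {a e k : ℝ} (ha : 0 < a) (he0 : 0 < e)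
    (he1 : e < 1) (hk0 : 0 < k) {A B A' B' : ℝ} :
    coneQuadric o M a e k A B = coneQuadric o M a e k A' B' ↔ A = A' ∧ B = B' := by
  refine ⟨fun h => coneForm_injective ha he0 he1 hk0 fun x y z hxyz => ?_, ?_⟩
  · rw [← mem_coneQuadric_iff o M] at hxyz ⊢
    rwa [← h]
  · rintro ⟨rfl, rfl⟩
    rfl

theorem eq_coneQuadric_of_inter_eq {M : EuclideanSpace ℝ (Fin 3)} {a e : ℝ} (ha : 0 < a)
    (he0 : 0 < e) (he1 : e < 1) {α : ℝ} (hα : 0 < Real.cos α) (hα1 : Real.cos α < 1)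
    {V d : EuclideanSpace ℝ (Fin 3)} (hd : ‖d‖ = 1)
    (h : ∀ x y, (1 - e ^ 2) * x ^ 2 + y ^ 2 = a ^ 2 * (1 - e ^ 2) →
      M + frameVector o x y 0 ∈ Cone V d α) :
    ∃ A B, A ^ 2 = Real.cos α ^ 2 * e ^ 2 * (1 - Real.cos α ^ 2 * e ^ 2) ∧
      B ^ 2 = Real.cos α ^ 2 * (1 - Real.cos α ^ 2) * a ^ 2 ∧
      Cone V d α = coneQuadric o M a e (Real.cos α ^ 2) A B := by
  obtain ⟨p, q, r, rfl⟩ := exists_eq_add_frameVector o M V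
  obtain ⟨l, m, n, rfl⟩ := exists_eq_frameVector o d
  rw [norm_frameVector, Real.sqrt_eq_one] at hd
  obtain ⟨A, B, hA, hB, hAB⟩ := exists_coneForm_of_vanish ha he0 he1 (pow_pos hα 2)
    (pow_lt_one₀ hα.le hα1 two_ne_zero) hd fun x y hxy =>
      sub_eq_zero.mp ((mem_Cone_frameVector_iff o M hα.le _ _ _ _ _ _ _ _ _).mp (h x y hxy))
  refine ⟨A, B, hA, hB, ?_⟩
  ext P
  obtain ⟨x, y, z, rfl⟩ := exists_eq_add_frameVector o M P
  rw [mem_Cone_frameVector_iff o M hα.le, mem_coneQuadric_iff, hAB]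

theorem exists_Cone_eq_coneQuadric (M : EuclideanSpace ℝ (Fin 3)) {a e : ℝ}
    (he0 : 0 < e) (he1 : e < 1) {α : ℝ} (hα : 0 < Real.cos α) (hα1 : Real.cos α < 1) {A B : ℝ}
    (hA : A ^ 2 = Real.cos α ^ 2 * e ^ 2 * (1 - Real.cos α ^ 2 * e ^ 2))
    (hB : B ^ 2 = Real.cos α ^ 2 * (1 - Real.cos α ^ 2) * a ^ 2) :
    ∃ V d, ‖d‖ = 1 ∧ coneQuadric o M a e (Real.cos α ^ 2) A B = Cone V d α := by
  obtain ⟨p, q, r, l, m, n, hu, hAB⟩ := exists_cone_of_coneForm he0 he1 (pow_pos hα 2)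
    (pow_lt_one₀ hα.le hα1 two_ne_zero) hA hB
  refine ⟨M + frameVector o p q r, frameVector o l m n, by rw [norm_frameVector, hu, Real.sqrt_one],
    ?_⟩
  ext P
  obtain ⟨x, y, z, rfl⟩ := exists_eq_add_frameVector o M P
  rw [mem_Cone_frameVector_iff o M hα.le, mem_coneQuadric_iff, hAB]

end frameVector

theorem Set.ncard_eq_four_of_distinct {α : Type*} {f : ℝ → ℝ → α} {A B : ℝ} (hA : 0 < A)
    (hB : 0 < B) (hf : ∀ A B A' B', f A B = f A' B' ↔ A = A' ∧ B = B') :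
    ({f A B, f A (-B), f (-A) B, f (-A) (-B)} : Set α).ncard = 4 := by
  have hA' : A ≠ -A := by linarith
  have hB' : B ≠ -B := by linarith
  rw [Set.ncard_insert_of_notMem, Set.ncard_insert_of_notMem, Set.ncard_pair] <;>
    simp [hf, hA', hB']

/-- For each bloom `θ ∈ (0, π)` there are exactly four cones of bloom `θ`
(half-angle `θ/2`) belonging to a given (noncircular) ellipse `E`. -/
theorem four_cones_of_given_bloom
    (Pl : AffineSubspace ℝ (EuclideanSpace ℝ (Fin 3)))
    (hPl : Module.finrank ℝ Pl.direction = 2)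
    (F₁ F₂ : EuclideanSpace ℝ (Fin 3)) (hF₁ : F₁ ∈ Pl) (hF₂ : F₂ ∈ Pl) (hFne : F₁ ≠ F₂)
    (a : ℝ) (ha : dist F₁ F₂ < 2 * a)
    (E : Set (EuclideanSpace ℝ (Fin 3)))
    (hE : E = {P | P ∈ Pl ∧ dist P F₁ + dist P F₂ = 2 * a})
    (θ : ℝ) (hθ : θ ∈ Set.Ioo 0 Real.pi) :
    Set.ncard {C : Set (EuclideanSpace ℝ (Fin 3)) |
      (∃ V d, ‖d‖ = 1 ∧ C = Cone V d (θ / 2)) ∧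
      C ∩ (Pl : Set (EuclideanSpace ℝ (Fin 3))) = E} = 4 := by
  obtain ⟨M, hMdef⟩ : ∃ M, M = midpoint ℝ F₁ F₂ := ⟨_, rfl⟩
  have hM : M ∈ Pl := by
    rw [hMdef]
    exact AffineMap.lineMap_mem _ hF₁ hF₂
  have hFM : F₂ ≠ M := by
    rw [hMdef]
    exact fun h => hFne ((midpoint_eq_right_iff ℝ).mp h.symm)
  obtain ⟨o, ho₀, ho₂⟩ := exists_orthonormalBasis_of_finrank_direction_eq_two hPl hF₂ hM hFM
  have hdist : ‖F₂ - M‖ = dist F₁ F₂ / 2 := by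
    rw [← dist_eq_norm, hMdef, dist_right_midpoint]
    simp; ring
  have ha0 : 0 < a := by linarith [dist_nonneg (x := F₁) (y := F₂)]
  obtain ⟨e, he⟩ : ∃ e, e * a = ‖F₂ - M‖ := ⟨‖F₂ - M‖ / a, by field_simp⟩
  have he0 : 0 < e := pos_of_mul_pos_left (he ▸ norm_pos_iff.mpr (sub_ne_zero.mpr hFM)) ha0.le
  have he1 : e < 1 := by
    apply lt_of_mul_lt_mul_right _ ha0.le
    linarith
  have hF₂' : F₂ = M + frameVector o (e * a) 0 0 := by
    rw [he, frameVector, zero_smul, zero_smul, add_zero, add_zero, ← ho₀]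
    abel
  have hF₁' : F₁ = M + frameVector o (-(e * a)) 0 0 := by
    have h₁ : F₁ = M - (F₂ - M) := by
      rw [hMdef, midpoint_eq_smul_add, invOf_eq_inv]
      module
    rw [h₁, ho₀, ← he, frameVector]
    module
  have hmemPl (x y z : ℝ) : M + frameVector o x y z ∈ Pl ↔ z = 0 := by
    have h₂ : o 2 = frameVector o 0 0 1 := by simp [frameVector]
    rw [ho₂, h₂, add_sub_cancel_left, inner_frameVector]
    simp
  have hmemE (x y z : ℝ) : M + frameVector o x y z ∈ E ↔
      z = 0 ∧ (1 - e ^ 2) * x ^ 2 + y ^ 2 = a ^ 2 * (1 - e ^ 2) := by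
    rw [hE, Set.mem_ofPred_eq, hmemPl]
    refine and_congr_right ?_
    rintro rfl
    rw [← sum_dist_eq_iff ha0 he0 he1, hF₁', hF₂', dist_add_left, dist_add_left, dist_eq_norm,
      dist_eq_norm, frameVector_sub, frameVector_sub, norm_frameVector, norm_frameVector]
    simp
  obtain ⟨hθ0, hθπ⟩ := hθ
  have hα : 0 < Real.cos (θ / 2) := Real.cos_pos_of_mem_Ioo ⟨by linarith, by linarith⟩
  have hα1 : Real.cos (θ / 2) < 1 := by
    rw [← Real.cos_zero]
    exact Real.cos_lt_cos_of_nonneg_of_le_pi le_rfl (by linarith) (by linarith)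
  obtain ⟨k, hk⟩ : ∃ k, k = Real.cos (θ / 2) ^ 2 := ⟨_, rfl⟩
  have hk0 : 0 < k := hk ▸ pow_pos hα 2
  have hk1 : k < 1 := hk ▸ pow_lt_one₀ hα.le hα1 two_ne_zero
  have hke : 0 < 1 - k * e ^ 2 := by nlinarith
  have hk1' : 0 < 1 - k := by linarith
  obtain ⟨A, hA0, hA⟩ : ∃ A, 0 < A ∧ A ^ 2 = k * e ^ 2 * (1 - k * e ^ 2) :=
    ⟨√(k * e ^ 2 * (1 - k * e ^ 2)), by positivity, Real.sq_sqrt (by positivity)⟩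
  obtain ⟨B, hB0, hB⟩ : ∃ B, 0 < B ∧ B ^ 2 = k * (1 - k) * a ^ 2 :=
    ⟨√(k * (1 - k) * a ^ 2), by positivity, Real.sq_sqrt (by positivity)⟩
  rw [← Set.ncard_eq_four_of_distinct (f := coneQuadric o M a e k) hA0 hB0
    fun _ _ _ _ => coneQuadric_inj o M ha0 he0 he1 hk0]
  have hquad {A' B' : ℝ} (hA' : A' ^ 2 = A ^ 2) (hB' : B' ^ 2 = B ^ 2) :
      (∃ V d, ‖d‖ = 1 ∧ coneQuadric o M a e k A' B' = Cone V d (θ / 2)) ∧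
        coneQuadric o M a e k A' B' ∩ (Pl : Set (EuclideanSpace ℝ (Fin 3))) = E := by
    constructor
    · rw [hk]
      exact exists_Cone_eq_coneQuadric o M he0 he1 hα hα1 (by rw [hA', hA, hk])
        (by rw [hB', hB, hk])
    · ext P
      obtain ⟨x, y, z, rfl⟩ := exists_eq_add_frameVector o M P
      rw [Set.mem_inter_iff, SetLike.mem_coe, hmemPl, hmemE, mem_coneQuadric_iff, and_comm]
      refine and_congr_right ?_
      rintro rfl
      have hform : coneForm a e k A' B' x y 0 =
          k * (a ^ 2 * (1 - e ^ 2) - ((1 - e ^ 2) * x ^ 2 + y ^ 2)) := by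
        unfold coneForm
        ring
      rw [hform, mul_eq_zero_iff_left hk0.ne', sub_eq_zero, eq_comm]
  congr 1
  ext C
  simp only [Set.mem_ofPred_eq, Set.mem_insert_iff, Set.mem_singleton_iff]
  constructor
  · rintro ⟨⟨V, d, hd, rfl⟩, hC⟩
    obtain ⟨A', B', hA', hB', h⟩ := eq_coneQuadric_of_inter_eq o (M := M) ha0 he0 he1 hα hα1 hd
      fun x y hxy => Set.inter_subset_left (hC ▸ (hmemE x y 0).mpr ⟨rfl, hxy⟩)
    rw [← hk] at hA' hB' h
    rw [h]
    rcases sq_eq_sq_iff_eq_or_eq_neg.mp (hA'.trans hA.symm) with rfl | rfl <;>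
      rcases sq_eq_sq_iff_eq_or_eq_neg.mp (hB'.trans hB.symm) with rfl | rfl <;> simp
  · rintro (rfl | rfl | rfl | rfl)
    exacts [hquad rfl rfl, hquad rfl (neg_sq B), hquad (neg_sq A) rfl,
      hquad (neg_sq A) (neg_sq B)]
end

section
/- Let E be an ellipse in a plane Π of ℝ³ with distinct foci F₁, F₂ and center O (the midpoint of F₁F₂), and let C be a cone with vertex V belonging to E, where F₁ is the focus nearer to V (dist V F₁ < dist V F₂). Then the axis of C intersects the line through F₁ and F₂ in a point J lying strictly between O and F₁. -/
/-- If the conic section `z = 0` of a cone with vertex `(p, q, h)` and axis direction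
`(d₁, d₂, d₃)` contains the ellipse with semi-axes `a`, `b` and `p > 0`, then the axis meets
the `x`-axis strictly between the center and the focus `(c, 0)`. -/
theorem exists_axis_point_of_section_contains_ellipse
    {a b c p q h d₁ d₂ d₃ k : ℝ} (ha : 0 < a) (hb : 0 < b) (hc : 0 < c)
    (habc : a ^ 2 = b ^ 2 + c ^ 2) (hd : d₁ ^ 2 + d₂ ^ 2 + d₃ ^ 2 = 1)
    (hk : 0 < k) (hk1 : k < 1) (hp : 0 < p)
    (hQ : ∀ x y : ℝ, x ^ 2 + y ^ 2 = 1 →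
      ((a * x - p) * d₁ + (b * y - q) * d₂ - h * d₃) ^ 2 =
        k * ((a * x - p) ^ 2 + (b * y - q) ^ 2 + h ^ 2)) :
    ∃ t j : ℝ, 0 < j ∧ j < c ∧ p + t * d₁ = j ∧ q + t * d₂ = 0 ∧ h + t * d₃ = 0 := by
  have hright := hQ 1 0 (by norm_num)
  have hleft := hQ (-1) 0 (by norm_num)
  have htop := hQ 0 1 (by norm_num)
  have hbot := hQ 0 (-1) (by norm_num)
  have hdiag := hQ (3 / 5) (4 / 5) (by norm_num)
  obtain ⟨s, hs⟩ : ∃ s, s = p * d₁ + q * d₂ + h * d₃ := ⟨_, rfl⟩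
  have hx : d₁ * s = k * p := mul_left_cancel₀ ha.ne' (by subst hs; linarith)
  have hy : d₂ * s = k * q := mul_left_cancel₀ hb.ne' (by subst hs; linarith)
  have hxx : (d₁ ^ 2 - k) * a ^ 2 = k * (p ^ 2 + q ^ 2 + h ^ 2) - s ^ 2 := by
    subst hs; linarith
  have hyy : (d₂ ^ 2 - k) * b ^ 2 = k * (p ^ 2 + q ^ 2 + h ^ 2) - s ^ 2 := by
    subst hs; linarith
  have hxy : a * b * (d₁ * d₂) = 0 := by
    have hx' : a * (d₁ * s) = a * (k * p) := by rw [hx]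
    have hy' : b * (d₂ * s) = b * (k * q) := by rw [hy]
    subst hs; linarith
  have hd₁ : d₁ ≠ 0 := by
    rintro rfl
    have := mul_pos hk hp
    linarith
  have hd₂ : d₂ = 0 := by
    simpa [ha.ne', hb.ne', hd₁] using hxy
  subst hd₂
  have hq : q = 0 := by simpa [hk.ne'] using hy.symm
  subst hq
  have hecc : d₁ ^ 2 * a ^ 2 = k * c ^ 2 := by
    linear_combination hxx - hyy + k * habc
  have hd₁k : d₁ ^ 2 < k := by
    have : 0 < k * b ^ 2 := by positivity
    nlinarith [sq_pos_of_pos ha]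
  have hd₃ : 0 < d₃ ^ 2 := by linarith
  have hd₃0 : d₃ ≠ 0 := by rintro rfl; norm_num at hd₃
  have hh : d₁ * d₃ * h = p * (k - d₁ ^ 2) := by
    subst hs; linear_combination hx
  have hj : (p - h / d₃ * d₁) * d₃ ^ 2 = p * (1 - k) := by
    field_simp
    linear_combination (-1 : ℝ) * hh + p * hd
  have hj0 : 0 < p - h / d₃ * d₁ := by
    have : 0 < p * (1 - k) := mul_pos hp (by linarith)
    rw [← hj] at this
    exact pos_of_mul_pos_left this hd₃.le
  have hpc : p ^ 2 * (1 - k) = c ^ 2 * d₃ ^ 2 := by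
    refine mul_left_cancel₀ (mul_pos hk (sub_pos.2 hd₁k)).ne' ?_
    linear_combination d₁ ^ 2 * d₃ ^ 2 * hxx - (d₁ ^ 2 - k) * d₃ ^ 2 * hecc
      + k * (d₁ * d₃ * h + p * (k - d₁ ^ 2)) * hh - d₃ ^ 2 * (d₁ * s + k * p) * hx
      - k * p ^ 2 * (k - d₁ ^ 2) * hd
  refine ⟨-(h / d₃), p - h / d₃ * d₁, hj0, ?_, by ring, by ring, by field_simp; ring⟩
  have hsq : (p - h / d₃ * d₁) ^ 2 * d₃ ^ 2 = c ^ 2 * (1 - k) := by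
    refine mul_right_cancel₀ hd₃.ne' ?_
    linear_combination ((p - h / d₃ * d₁) * d₃ ^ 2 + p * (1 - k)) * hj + (1 - k) * hpc
  refine lt_of_pow_lt_pow_left₀ 2 hc.le (lt_of_mul_lt_mul_right ?_ hd₃.le)
  rw [hsq]
  exact mul_lt_mul_of_pos_left (by linarith) (by positivity)

/-- A unit vector of a plane direction in space extends to an orthonormal basis of the space whose
second vector also lies in the direction. -/
theorem exists_orthonormalBasis_of_mem_of_finrank_eq_two
    (S : Submodule ℝ (EuclideanSpace ℝ (Fin 3))) (hS : Module.finrank ℝ S = 2)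
    {u : EuclideanSpace ℝ (Fin 3)} (hu : ‖u‖ = 1) (huS : u ∈ S) :
    ∃ e : OrthonormalBasis (Fin 3) ℝ (EuclideanSpace ℝ (Fin 3)), e 0 = u ∧ e 1 ∈ S := by
  obtain ⟨f, hf⟩ := Orthonormal.exists_orthonormalBasis_extension_of_card_eq (𝕜 := ℝ) (E := S)
    (ι := Fin 2) (by simpa using hS) (v := fun _ => ⟨u, huS⟩) (s := {0})
    (by rw [orthonormal_iff_ite]
        rintro ⟨i, rfl⟩ ⟨j, rfl⟩
        simp [hu])
  have hf0 : (f 0 : EuclideanSpace ℝ (Fin 3)) = u := by rw [hf 0 rfl]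
  have hfo := f.orthonormal.comp_linearIsometry S.subtypeₗᵢ
  obtain ⟨e, he⟩ := Orthonormal.exists_orthonormalBasis_extension_of_card_eq (𝕜 := ℝ)
    (E := EuclideanSpace ℝ (Fin 3)) (ι := Fin 3) (by simp)
    (v := ![(f 0 : EuclideanSpace ℝ (Fin 3)), f 1, 0]) (s := {0, 1})
    (by
      rw [orthonormal_iff_ite] at hfo ⊢
      have h00 := hfo 0 0
      have h01 := hfo 0 1
      have h10 := hfo 1 0
      have h11 := hfo 1 1
      simp only [Function.comp, Submodule.coe_subtypeₗᵢ, Submodule.subtype_apply] at h00 h01 h10 h11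
      rintro ⟨i, rfl | rfl⟩ ⟨j, rfl | rfl⟩ <;> simp [Subtype.ext_iff, h01, h10] <;> simp_all)
  refine ⟨e, ?_, ?_⟩
  · rw [he 0 (by simp)]; simpa using hf0
  · rw [he 1 (by simp)]; simp


open scoped RealInnerProductSpace

/-- The axis of a cone belonging to a noncircular ellipse meets the major-axis line
in a point lying strictly between the center `O` of the ellipse and the focus `F₁`
nearer to the cone's vertex. -/
theorem cone_axis_meets_major_axis
    (Pl : AffineSubspace ℝ (EuclideanSpace ℝ (Fin 3)))
    (hPl : Module.finrank ℝ Pl.direction = 2)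
    (F₁ F₂ : EuclideanSpace ℝ (Fin 3)) (hF₁ : F₁ ∈ Pl) (hF₂ : F₂ ∈ Pl) (hFne : F₁ ≠ F₂)
    (a : ℝ) (ha : dist F₁ F₂ < 2 * a)
    (E : Set (EuclideanSpace ℝ (Fin 3)))
    (hE : E = {P | P ∈ Pl ∧ dist P F₁ + dist P F₂ = 2 * a})
    (O : EuclideanSpace ℝ (Fin 3)) (hO : O = midpoint ℝ F₁ F₂)
    (V d : EuclideanSpace ℝ (Fin 3)) (hd : ‖d‖ = 1)
    (α : ℝ) (hα : α ∈ Set.Ioo 0 (Real.pi / 2))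
    (C : Set (EuclideanSpace ℝ (Fin 3))) (hC : C = Cone V d α)
    (hCE : C ∩ (Pl : Set (EuclideanSpace ℝ (Fin 3))) = E)
    (hnear : dist V F₁ < dist V F₂) :
    ∃ J : EuclideanSpace ℝ (Fin 3),
      J ∈ AffineSubspace.mk' V (Submodule.span ℝ {d}) ∧ Sbtw ℝ O J F₁ := by
  obtain ⟨hα0, hα1⟩ := hα
  obtain ⟨w, hw⟩ : ∃ w, w = F₁ - O := ⟨_, rfl⟩
  have hF₁w : F₁ = O + w := by rw [hw]; abel
  have hF₂w : F₂ = O - w := by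
    rw [hw, hO, midpoint_eq_smul_add, invOf_eq_inv]
    module
  have hOPl : O ∈ Pl := hO ▸ AffineMap.lineMap_mem _ hF₁ hF₂
  have hw0 : w ≠ 0 := by
    rintro rfl
    exact hFne (by simp [hF₁w, hF₂w])
  obtain ⟨c, hc⟩ : ∃ c, c = ‖w‖ := ⟨_, rfl⟩
  have hc0 : 0 < c := hc ▸ norm_pos_iff.2 hw0
  have hwS : w ∈ Pl.direction := hw ▸ AffineSubspace.vsub_mem_direction hF₁ hOPl
  obtain ⟨e, he0, he1⟩ := exists_orthonormalBasis_of_mem_of_finrank_eq_two Pl.direction hPl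
    (u := c⁻¹ • w) (by rw [norm_smul, ← hc, norm_inv, Real.norm_of_nonneg hc0.le,
      inv_mul_cancel₀ hc0.ne']) (Pl.direction.smul_mem _ hwS)
  have hwe : w = c • e 0 := by rw [he0, smul_inv_smul₀ hc0.ne']
  have hca : c < a := by
    have : dist F₁ F₂ = 2 * c := by
      rw [hF₁w, hF₂w, dist_eq_norm, show O + w - (O - w) = (2 : ℝ) • w by module, norm_smul, ← hc]
      norm_num
    linarith
  obtain ⟨b, hb⟩ : ∃ b, b = √(a ^ 2 - c ^ 2) := ⟨_, rfl⟩
  have hac : 0 < a ^ 2 - c ^ 2 := by nlinarith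
  have hb0 : 0 < b := hb ▸ Real.sqrt_pos.2 hac
  have habc : a ^ 2 = b ^ 2 + c ^ 2 := by rw [hb, Real.sq_sqrt hac.le]; ring
  have hnorm (x : EuclideanSpace ℝ (Fin 3)) :
      ‖x‖ ^ 2 = e.repr x 0 ^ 2 + e.repr x 1 ^ 2 + e.repr x 2 ^ 2 := by
    rw [← e.repr.norm_map, EuclideanSpace.norm_sq_eq, Fin.sum_univ_three]
    simp
  have hinner (x y : EuclideanSpace ℝ (Fin 3)) :
      ⟪x, y⟫ = e.repr x 0 * e.repr y 0 + e.repr x 1 * e.repr y 1 + e.repr x 2 * e.repr y 2 := by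
    rw [← e.repr.inner_map_map, PiLp.inner_apply, Fin.sum_univ_three]
    simp [mul_comm]
  have hdist (x y z : ℝ) (hxy : x ^ 2 + y ^ 2 = 1) (hz : z ^ 2 = 1) :
      dist (O + (a * x) • e 0 + (b * y) • e 1) (O + z • w) = a - z * c * x := by
    have hzx : |z * x| ≤ 1 := by
      rw [← sq_le_one_iff_abs_le_one]; nlinarith [sq_nonneg y]
    have hnn : 0 ≤ a - z * c * x := by nlinarith [abs_le.1 hzx]
    rw [← sq_eq_sq₀ dist_nonneg hnn, dist_eq_norm, hnorm, hwe]
    simp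
    linear_combination (b ^ 2) * hxy + (c ^ 2 - c ^ 2 * x ^ 2) * hz - (1 - x ^ 2) * habc
  have hp : 0 < e.repr (V - O) 0 := by
    have h := (sq_lt_sq₀ dist_nonneg dist_nonneg).2 hnear
    rw [dist_eq_norm, dist_eq_norm, hF₁w, hF₂w, show V - (O + w) = V - O - w by abel,
      show V - (O - w) = V - O + w by abel, hnorm, hnorm, hwe] at h
    simp only [map_add, map_sub, map_smul, e.repr_self] at h ⊢
    simp at h ⊢
    nlinarith
  have hcos0 : 0 < Real.cos α := Real.cos_pos_of_mem_Ioo ⟨by linarith, hα1⟩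
  have hcos1 : Real.cos α < 1 := by
    simpa using Real.cos_lt_cos_of_nonneg_of_le_pi_div_two le_rfl hα1.le hα0
  obtain ⟨t, j, hj0, hjc, h0, h1, h2⟩ :=
    exists_axis_point_of_section_contains_ellipse (a := a) (b := b) (c := c)
      (p := e.repr (V - O) 0) (q := e.repr (V - O) 1) (h := e.repr (V - O) 2)
      (d₁ := e.repr d 0) (d₂ := e.repr d 1) (d₃ := e.repr d 2) (k := Real.cos α ^ 2)
      (hc0.trans hca) hb0 hc0 habc (by rw [← hnorm, hd, one_pow]) (by positivity)
      (by nlinarith) hp (by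
        intro x y hxy
        have hmem : O + (a * x) • e 0 + (b * y) • e 1 ∈ C ∩ (Pl : Set _) := by
          rw [hCE, hE]
          refine ⟨?_, ?_⟩
          · have he0S : e 0 ∈ Pl.direction := he0 ▸ Pl.direction.smul_mem _ hwS
            have := AffineSubspace.vadd_mem_of_mem_direction
              (Pl.direction.add_mem (Pl.direction.smul_mem (a * x) he0S)
                (Pl.direction.smul_mem (b * y) he1)) hOPl
            rwa [vadd_eq_add, add_comm, ← add_assoc] at this
          · have h1 := hdist x y 1 hxy (by norm_num)
            have h2 := hdist x y (-1) hxy (by norm_num)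
            rw [one_smul, ← hF₁w] at h1
            rw [neg_one_smul, ← sub_eq_add_neg, ← hF₂w] at h2
            rw [h1, h2]; ring
        have hcone := hmem.1
        rw [hC] at hcone
        have hsq := congrArg (· ^ 2) (show |⟪_, _⟫| = _ from hcone)
        simp only [sq_abs, mul_pow] at hsq
        rw [show O + (a * x) • e 0 + (b * y) • e 1 - V
          = (a * x) • e 0 + (b * y) • e 1 - (V - O) by abel, hnorm, hinner] at hsq
        rw [mul_comm (Real.cos α ^ 2)]
        convert hsq using 2 <;> simp <;> ring)
  have hJ : AffineMap.lineMap O F₁ (j / c) = V + t • d := by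
    have : j • e 0 = V - O + t • d := by
      apply e.repr.injective
      ext i
      fin_cases i <;> simp at h0 h1 h2 ⊢ <;> linarith
    rw [AffineMap.lineMap_apply, vsub_eq_sub, ← hw, hwe, smul_smul, div_mul_cancel₀ _ hc0.ne', this,
      vadd_eq_add]
    abel
  refine ⟨AffineMap.lineMap O F₁ (j / c), ?_, ?_⟩
  · rw [hJ, AffineSubspace.mem_mk', vsub_eq_sub, add_sub_cancel_left]
    exact Submodule.smul_mem _ _ (Submodule.mem_span_singleton_self d)
  · rw [sbtw_lineMap_iff]
    refine ⟨?_, by positivity, (div_lt_one hc0).2 hjc⟩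
    rw [hF₁w]
    simpa using hw0
end

section
/- Let E be an ellipse in a plane Π of ℝ³ with distinct foci F₁, F₂, eccentricity 0 < e < 1, and center O. Then the collection of subsets C of ℝ³ such that C is a cylinder and C ∩ Π = E has exactly two elements; moreover, the axis of each such cylinder passes through O, lies in the plane Π′ through F₁ and F₂ perpendicular to Π, and makes an angle ψ with the line through F₁ and F₂ satisfying cos ψ = e (the two axes being the asymptotes of the hyperbola in Π′ with foci at the major-axis endpoints A, P and vertices F₁, F₂). -/
open scoped RealInnerProductSpace

/-- The cylinder of radius `w` whose axis is the line through `Q` with direction `v`. -/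
def Cyl (Q v : EuclideanSpace ℝ (Fin 3)) (w : ℝ) : Set (EuclideanSpace ℝ (Fin 3)) :=
  {P | Metric.infDist P
        (AffineSubspace.mk' Q (Submodule.span ℝ {v}) : Set (EuclideanSpace ℝ (Fin 3))) = w}

/-- A subset of `ℝ³` is a cylinder if it is the set of points at some fixed positive
distance from some line. -/
def IsCylinder (C : Set (EuclideanSpace ℝ (Fin 3))) : Prop :=
  ∃ Q v w, v ≠ 0 ∧ 0 < w ∧ C = Cyl Q v w

/-- Membership in a cylinder with unit axis direction, by Pythagoras. -/
theorem mem_Cyl_iff {Q v P : EuclideanSpace ℝ (Fin 3)} {w : ℝ} (hv : ‖v‖ = 1) (hw : 0 ≤ w) :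
    P ∈ Cyl Q v w ↔ ‖P - Q‖ ^ 2 - ⟪v, P - Q⟫ ^ 2 = w ^ 2 := by
  have key : ∀ t : ℝ, ‖P - Q - t • v‖ ^ 2 =
      ‖P - Q‖ ^ 2 - ⟪v, P - Q⟫ ^ 2 + (t - ⟪v, P - Q⟫) ^ 2 := by
    intro t
    rw [norm_sub_sq_real, inner_smul_right, norm_smul, hv, real_inner_comm, mul_one,
      Real.norm_eq_abs, sq_abs]
    ring
  have hinf : Metric.infDist P
      (AffineSubspace.mk' Q (Submodule.span ℝ {v}) : Set (EuclideanSpace ℝ (Fin 3))) =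
      ‖P - Q - ⟪v, P - Q⟫ • v‖ := by
    apply le_antisymm
    · have hmem : ⟪v, P - Q⟫ • v + Q ∈
          (AffineSubspace.mk' Q (Submodule.span ℝ {v}) : Set (EuclideanSpace ℝ (Fin 3))) := by
        simp [AffineSubspace.mem_mk', Submodule.mem_span_singleton]
      refine (Metric.infDist_le_dist_of_mem hmem).trans_eq ?_
      rw [dist_eq_norm]
      congr 1
      abel
    · refine (Metric.le_infDist ⟨Q, AffineSubspace.self_mem_mk' _ _⟩).2 ?_
      intro R hR
      rw [SetLike.mem_coe, AffineSubspace.mem_mk', Submodule.mem_span_singleton] at hR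
      obtain ⟨t, ht⟩ := hR
      have hPR : P - R = P - Q - t • v := by
        rw [ht, vsub_eq_sub]
        abel
      rw [dist_eq_norm, hPR]
      refine le_of_sq_le_sq ?_ (norm_nonneg _)
      rw [key, key]
      nlinarith [sq_nonneg (t - ⟪v, P - Q⟫)]
  rw [Cyl, Set.mem_ofPred_eq, hinf, ← sq_eq_sq₀ (norm_nonneg _) hw, key]
  simp

theorem Cyl_smul (Q v : EuclideanSpace ℝ (Fin 3)) (w : ℝ) {t : ℝ} (ht : t ≠ 0) :
    Cyl Q (t • v) w = Cyl Q v w := by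
  rw [Cyl, Cyl, Submodule.span_singleton_smul_eq (IsUnit.mk0 t ht)]

theorem Cyl_add_smul (O v : EuclideanSpace ℝ (Fin 3)) (w t : ℝ) :
    Cyl (O + t • v) v w = Cyl O v w := by
  have h : AffineSubspace.mk' (O + t • v) (Submodule.span ℝ {v}) =
      AffineSubspace.mk' O (Submodule.span ℝ {v}) := by
    have hmem : O + t • v ∈ AffineSubspace.mk' O (Submodule.span ℝ {v}) := by
      simp [AffineSubspace.mem_mk', Submodule.mem_span_singleton]
    have := AffineSubspace.mk'_eq hmem
    rwa [AffineSubspace.direction_mk'] at this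
  rw [Cyl, Cyl, h]

/-- The bifocal description of an ellipse in terms of its Cartesian equation. -/
theorem focal_sum_iff {a c x y r₁ r₂ : ℝ} (hc : 0 < c) (hca : c < a) (hr₁ : 0 ≤ r₁)
    (hr₂ : 0 ≤ r₂) (h₁ : r₁ ^ 2 = (x + c) ^ 2 + y ^ 2) (h₂ : r₂ ^ 2 = (x - c) ^ 2 + y ^ 2) :
    r₁ + r₂ = 2 * a ↔ (a ^ 2 - c ^ 2) * x ^ 2 + a ^ 2 * y ^ 2 = a ^ 2 * (a ^ 2 - c ^ 2) := by
  have ha : 0 < a := hc.trans hca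
  constructor
  · intro h
    obtain rfl : r₂ = 2 * a - r₁ := by linarith
    have h3 : a * r₁ = a ^ 2 + c * x := by linarith
    have h4 : (a * r₁) ^ 2 = (a ^ 2 + c * x) ^ 2 := by rw [h3]
    rw [mul_pow, h₁] at h4
    linarith
  · intro h
    have hx : x ^ 2 ≤ a ^ 2 := by
      have hpos : 0 < a ^ 2 - c ^ 2 := by nlinarith
      by_contra! hlt
      nlinarith [mul_pos hpos (sub_pos.2 hlt), mul_nonneg (sq_nonneg a) (sq_nonneg y)]
    obtain ⟨hx₁, hx₂⟩ := abs_le_of_sq_le_sq' hx ha.le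
    have e₁ : a * r₁ = a ^ 2 + c * x := by
      refine (sq_eq_sq₀ (by positivity) (by nlinarith)).1 ?_
      rw [mul_pow, h₁]
      linarith
    have e₂ : a * r₂ = a ^ 2 - c * x := by
      refine (sq_eq_sq₀ (by positivity) (by nlinarith)).1 ?_
      rw [mul_pow, h₂]
      linarith
    refine mul_left_cancel₀ ha.ne' ?_
    linarith

/-- The coefficients of a cylinder whose trace on the plane `z = 0` contains the ellipse
`x² / a² + y² / b² = 1`. -/
theorem cylinder_coefficients {a b c α β γ q₁ q₂ q₃ w : ℝ} (hb : 0 < b) (hc : 0 < c)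
    (hca : c < a) (hbc : b ^ 2 = a ^ 2 - c ^ 2) (hv : α ^ 2 + β ^ 2 + γ ^ 2 = 1)
    (h : ∀ x y : ℝ, b ^ 2 * x ^ 2 + a ^ 2 * y ^ 2 = a ^ 2 * b ^ 2 →
      (x - q₁) ^ 2 + (y - q₂) ^ 2 + q₃ ^ 2 -
        (α * (x - q₁) + β * (y - q₂) - γ * q₃) ^ 2 = w ^ 2) :
    β = 0 ∧ a ^ 2 * α ^ 2 = c ^ 2 ∧ a ^ 2 * γ ^ 2 = b ^ 2 ∧ q₂ = 0 ∧ γ * q₁ = α * q₃ ∧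
      w ^ 2 = b ^ 2 := by
  have ha : 0 < a := hc.trans hca
  have h1 := h a 0 (by ring)
  have h2 := h (-a) 0 (by ring)
  have h3 := h 0 b (by ring)
  have h4 := h 0 (-b) (by ring)
  have h5 := h (3 / 5 * a) (4 / 5 * b) (by ring)
  have h6 := h (-(3 / 5 * a)) (-(4 / 5 * b)) (by ring)
  have hD : q₁ - α * (α * q₁ + β * q₂ + γ * q₃) = 0 := by
    refine mul_left_cancel₀ ha.ne' ?_
    linarith
  have hE : q₂ - β * (α * q₁ + β * q₂ + γ * q₃) = 0 := by
    refine mul_left_cancel₀ hb.ne' ?_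
    linarith
  have hαβ : α * β = 0 := by
    refine mul_left_cancel₀ (mul_pos ha hb).ne' ?_
    linarith
  have hab : (1 - α ^ 2) * a ^ 2 = (1 - β ^ 2) * b ^ 2 := by linarith
  have hβ : β = 0 := by
    rcases mul_eq_zero.1 hαβ with hα | hβ
    · subst hα
      nlinarith [mul_nonneg (sq_nonneg β) (sq_nonneg b)]
    · exact hβ
  subst hβ
  have hγ : a ^ 2 * γ ^ 2 = b ^ 2 := by
    have : γ ^ 2 = 1 - α ^ 2 := by linarith
    rw [this]
    linarith
  have hγ0 : γ ≠ 0 := by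
    rintro rfl
    nlinarith
  have hq₂ : q₂ = 0 := by linarith
  have hq : γ * q₁ = α * q₃ := by
    refine mul_left_cancel₀ hγ0 ?_
    linear_combination hD + q₁ * hv
  subst hq₂
  refine ⟨rfl, by linarith, hγ, rfl, hq, ?_⟩
  have hq0 : q₁ ^ 2 + q₃ ^ 2 - (α * q₁ + γ * q₃) ^ 2 = 0 := by
    linear_combination (γ * q₁ - α * q₃) * hq - (q₁ ^ 2 + q₃ ^ 2) * hv
  linarith

section Frame

variable (B : OrthonormalBasis (Fin 3) ℝ (EuclideanSpace ℝ (Fin 3)))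

theorem inner_eq_frame (p q : EuclideanSpace ℝ (Fin 3)) :
    ⟪p, q⟫ = ⟪B 0, p⟫ * ⟪B 0, q⟫ + ⟪B 1, p⟫ * ⟪B 1, q⟫ + ⟪B 2, p⟫ * ⟪B 2, q⟫ := by
  rw [← B.sum_inner_mul_inner p q, Fin.sum_univ_three]
  simp only [real_inner_comm]

theorem norm_sq_eq_frame (p : EuclideanSpace ℝ (Fin 3)) :
    ‖p‖ ^ 2 = ⟪B 0, p⟫ ^ 2 + ⟪B 1, p⟫ ^ 2 + ⟪B 2, p⟫ ^ 2 := by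
  rw [← real_inner_self_eq_norm_sq, inner_eq_frame B]
  ring

theorem ext_frame {p q : EuclideanSpace ℝ (Fin 3)} (h₀ : ⟪B 0, p⟫ = ⟪B 0, q⟫)
    (h₁ : ⟪B 1, p⟫ = ⟪B 1, q⟫) (h₂ : ⟪B 2, p⟫ = ⟪B 2, q⟫) : p = q := by
  rw [← sub_eq_zero, ← norm_eq_zero, ← sq_eq_zero_iff, norm_sq_eq_frame B]
  simp [inner_sub_right, h₀, h₁, h₂]

theorem inner_frame (i j : Fin 3) : ⟪B i, B j⟫ = if i = j then 1 else 0 :=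
  B.inner_eq_ite i j

theorem mem_Cyl_iff_frame {O P : EuclideanSpace ℝ (Fin 3)} {α γ w : ℝ}
    (hv : α ^ 2 + γ ^ 2 = 1) (hw : 0 ≤ w) :
    P ∈ Cyl O (α • B 0 + γ • B 2) w ↔
      (γ * ⟪B 0, P - O⟫ - α * ⟪B 2, P - O⟫) ^ 2 + ⟪B 1, P - O⟫ ^ 2 = w ^ 2 := by
  have hv' : ‖α • B 0 + γ • B 2‖ = 1 := by
    rw [← sq_eq_sq₀ (norm_nonneg _) zero_le_one, norm_sq_eq_frame B]
    simp [inner_add_right, inner_smul_right, hv]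
  rw [mem_Cyl_iff hv' hw, norm_sq_eq_frame B, inner_add_left, real_inner_smul_left,
    real_inner_smul_left]
  have : ∀ x y z : ℝ, x ^ 2 + y ^ 2 + z ^ 2 - (α * x + γ * z) ^ 2 =
      (γ * x - α * z) ^ 2 + y ^ 2 := by
    intro x y z
    linear_combination (-(x ^ 2 + z ^ 2)) * hv
  rw [this]

/-- The cylinders whose trace on the plane `z = 0` is the ellipse `x² / a² + y² / b² = 1`. -/
theorem isCylinder_and_inter_iff {Pl : AffineSubspace ℝ (EuclideanSpace ℝ (Fin 3))}
    {E : Set (EuclideanSpace ℝ (Fin 3))} {O : EuclideanSpace ℝ (Fin 3)} {a b c : ℝ}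
    (hb : 0 < b) (hc : 0 < c) (hca : c < a) (hbc : b ^ 2 = a ^ 2 - c ^ 2)
    (hPl : ∀ P, P ∈ Pl ↔ ⟪B 2, P - O⟫ = 0)
    (hE : ∀ P, P ∈ E ↔ P ∈ Pl ∧
      b ^ 2 * ⟪B 0, P - O⟫ ^ 2 + a ^ 2 * ⟪B 1, P - O⟫ ^ 2 = a ^ 2 * b ^ 2)
    (C : Set (EuclideanSpace ℝ (Fin 3))) :
    (IsCylinder C ∧ C ∩ (Pl : Set (EuclideanSpace ℝ (Fin 3))) = E) ↔
      C = Cyl O ((c / a) • B 0 + (b / a) • B 2) b ∨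
      C = Cyl O ((c / a) • B 0 + (-(b / a)) • B 2) b := by
  have ha : 0 < a := hc.trans hca
  have hunit : (c / a) ^ 2 + (b / a) ^ 2 = 1 := by
    field_simp
    linarith
  constructor
  · rintro ⟨⟨Q, v', w, hv', hw, rfl⟩, hCE⟩
    obtain ⟨v, hv, hCyl⟩ : ∃ v, ‖v‖ = 1 ∧ Cyl Q v' w = Cyl Q v w :=
      ⟨‖v'‖⁻¹ • v', norm_smul_inv_norm hv',
        (Cyl_smul Q v' w (inv_ne_zero (norm_ne_zero_iff.2 hv'))).symm⟩
    rw [hCyl] at hCE ⊢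
    have hv2 := norm_sq_eq_frame B v
    rw [hv, one_pow] at hv2
    obtain ⟨hβ, hα, hγ, hq₂, hq, hwb⟩ := cylinder_coefficients (q₁ := ⟪B 0, Q - O⟫)
        (q₂ := ⟪B 1, Q - O⟫) (q₃ := ⟪B 2, Q - O⟫) (w := w) hb hc hca hbc hv2.symm (by
      intro x y hxy
      have hmem : O + (x • B 0 + y • B 1) ∈ E := by
        rw [hE, hPl]
        simp [inner_add_right, inner_smul_right, hxy]
      rw [← hCE] at hmem
      have hmem := (mem_Cyl_iff hv hw.le).1 hmem.1
      have hsub : O + (x • B 0 + y • B 1) - Q = (x • B 0 + y • B 1) - (Q - O) := by abel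
      rw [hsub, norm_sq_eq_frame B, inner_eq_frame B v] at hmem
      simp only [inner_sub_right (B _) (x • B 0 + y • B 1), inner_add_right, inner_smul_right,
        inner_frame] at hmem
      simp at hmem
      rwa [← sub_eq_add_neg] at hmem)
    have hwb' : w = b := (sq_eq_sq₀ hw.le hb.le).1 hwb
    subst hwb'
    have hγ0 : ⟪B 2, v⟫ ≠ 0 := by
      intro h0
      rw [h0] at hγ
      nlinarith
    have hQ : Q = O + (⟪B 2, Q - O⟫ / ⟪B 2, v⟫) • v := by
      rw [← sub_eq_iff_eq_add']
      refine ext_frame B ?_ ?_ ?_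
      · rw [inner_smul_right]
        field_simp
        linarith
      · rw [inner_smul_right, hβ, hq₂, mul_zero]
      · rw [inner_smul_right]
        field_simp
    rw [hQ, Cyl_add_smul]
    have hvB : v = ⟪B 0, v⟫ • B 0 + ⟪B 2, v⟫ • B 2 := by
      refine ext_frame B ?_ ?_ ?_ <;>
      simp [inner_add_right, inner_smul_right, hβ]
    have hα' : ⟪B 0, v⟫ = c / a ∨ ⟪B 0, v⟫ = -(c / a) := by
      rw [← sq_eq_sq_iff_eq_or_eq_neg]
      field_simp
      linarith
    have hγ' : ⟪B 2, v⟫ = w / a ∨ ⟪B 2, v⟫ = -(w / a) := by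
      rw [← sq_eq_sq_iff_eq_or_eq_neg]
      field_simp
      linarith
    have hneg : ∀ v, Cyl O v w = Cyl O (-v) w := by
      intro v
      rw [← neg_one_smul ℝ v, Cyl_smul _ _ _ (by norm_num)]
    rcases hα' with h0 | h0 <;> rcases hγ' with h2 | h2 <;> rw [h0, h2] at hvB
    · left; rw [hvB]
    · right; rw [hvB]
    · right; rw [hvB, hneg]; congr 1; module
    · left; rw [hvB, hneg]; congr 1; module
  · have main : ∀ s : ℝ, s ^ 2 = (b / a) ^ 2 →
        IsCylinder (Cyl O ((c / a) • B 0 + s • B 2) b) ∧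
          Cyl O ((c / a) • B 0 + s • B 2) b ∩ (Pl : Set (EuclideanSpace ℝ (Fin 3))) = E := by
      intro s hs
      refine ⟨⟨O, _, b, ?_, hb, rfl⟩, ?_⟩
      · intro h0
        have := congrArg (fun p => ⟪B 0, p⟫) h0
        simp [inner_add_right, inner_smul_right, hc.ne', ha.ne'] at this
      · ext P
        rw [Set.mem_inter_iff, mem_Cyl_iff_frame B (by rw [hs, hunit]) hb.le, hE, and_comm,
          SetLike.mem_coe]
        refine and_congr_right fun hP => ?_
        rw [(hPl P).1 hP, mul_zero, sub_zero, mul_pow, hs]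
        field_simp
    rintro (rfl | rfl)
    · exact main _ rfl
    · exact main _ (neg_sq _)

theorem Cyl_ne_Cyl_reflection {O : EuclideanSpace ℝ (Fin 3)} {α γ w : ℝ} (hα : α ≠ 0)
    (hγ : γ ≠ 0) (hv : α ^ 2 + γ ^ 2 = 1) (hw : 0 < w) :
    Cyl O (α • B 0 + γ • B 2) w ≠ Cyl O (α • B 0 + (-γ) • B 2) w := by
  intro h
  have h1 : O + ((w / (2 * γ)) • B 0 + (-(w / (2 * α))) • B 2) ∈
      Cyl O (α • B 0 + γ • B 2) w := by
    rw [mem_Cyl_iff_frame B hv hw.le]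
    simp only [add_sub_cancel_left, inner_add_right, inner_smul_right, inner_frame]
    simp
    field_simp
    ring
  rw [h, mem_Cyl_iff_frame B (by rw [neg_sq, hv]) hw.le] at h1
  simp only [add_sub_cancel_left, inner_add_right, inner_smul_right, inner_frame] at h1
  simp at h1
  field_simp at h1
  ring_nf at h1
  simp at h1

end Frame

/-- An orthonormal frame adapted to a plane and a unit vector in it. -/
theorem exists_adapted_frame {D : Submodule ℝ (EuclideanSpace ℝ (Fin 3))}
    (hD : Module.finrank ℝ D = 2) {u : EuclideanSpace ℝ (Fin 3)} (hu : u ∈ D)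
    (hu1 : ‖u‖ = 1) :
    ∃ B : OrthonormalBasis (Fin 3) ℝ (EuclideanSpace ℝ (Fin 3)),
      B 0 = u ∧ Dᗮ = Submodule.span ℝ {B 2} ∧ ∀ p, p ∈ D ↔ ⟪B 2, p⟫ = 0 := by
  have hfin : Module.finrank ℝ Dᗮ = 1 := by
    have := D.finrank_add_finrank_orthogonal
    rw [hD, finrank_euclideanSpace_fin] at this
    omega
  obtain ⟨n, hn, hn1⟩ : ∃ n ∈ Dᗮ, ‖n‖ = 1 := by
    have : Nontrivial Dᗮ := Module.nontrivial_of_finrank_pos (R := ℝ) (by omega)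
    obtain ⟨n, hn⟩ := exists_norm_eq Dᗮ zero_le_one
    exact ⟨n, n.2, hn⟩
  have hun : ⟪u, n⟫ = 0 := hn u hu
  have hon : Orthonormal ℝ (({0, 2} : Set (Fin 3)).domRestrict ![u, 0, n]) := by
    constructor
    · rintro ⟨i, rfl | rfl⟩
      · exact hu1
      · exact hn1
    · rintro ⟨i, rfl | rfl⟩ ⟨j, rfl | rfl⟩ hij
      · exact absurd rfl hij
      · exact hun
      · exact (real_inner_comm _ _).trans hun
      · exact absurd rfl hij
  obtain ⟨B, hB⟩ := hon.exists_orthonormalBasis_extension_of_card_eq (by simp)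
  have hB0 : B 0 = u := by simpa using hB 0 (by simp)
  have hB2 : B 2 = n := by simpa using hB 2 (by simp)
  have hspan : Dᗮ = Submodule.span ℝ {B 2} := by
    rw [hB2]
    symm
    refine Submodule.eq_of_le_of_finrank_eq ?_ ?_
    · simpa using hn
    · rw [hfin, finrank_span_singleton]
      rintro rfl
      simp at hn1
  refine ⟨B, hB0, hspan, fun p => ?_⟩
  rw [← D.orthogonal_orthogonal, hspan, Submodule.mem_orthogonal_singleton_iff_inner_right]

/-- A line through the midpoint of `F₁` and `F₂` with direction in the span of `F₂ - F₁` and `n`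
lies in the plane through `F₁` spanned by these vectors. -/
theorem mk'_midpoint_le {F₁ F₂ n v : EuclideanSpace ℝ (Fin 3)}
    (hv : v ∈ Submodule.span ℝ {F₂ - F₁, n}) :
    AffineSubspace.mk' (midpoint ℝ F₁ F₂) (Submodule.span ℝ {v}) ≤
      AffineSubspace.mk' F₁ (Submodule.span ℝ {F₂ - F₁, n}) := by
  intro P hP
  rw [AffineSubspace.mem_mk'] at hP ⊢
  have hle : Submodule.span ℝ {v} ≤ Submodule.span ℝ {F₂ - F₁, n} := by simpa using hv
  rw [← vsub_add_vsub_cancel P (midpoint ℝ F₁ F₂) F₁]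
  refine Submodule.add_mem _ (hle hP) ?_
  rw [midpoint_vsub_left]
  exact Submodule.smul_mem _ _ (Submodule.subset_span (by simp))

/-- There are exactly two cylinders belonging to an ellipse `E` with `0 < e < 1`;
each has its axis through the center `O`, lying in the plane `Π′` through the foci
perpendicular to `Π`, and making an angle `ψ` with the major-axis line with `cos ψ = e`. -/
theorem two_cylinders_of_ellipse
    (Pl : AffineSubspace ℝ (EuclideanSpace ℝ (Fin 3)))
    (hPl : Module.finrank ℝ Pl.direction = 2)
    (F₁ F₂ : EuclideanSpace ℝ (Fin 3)) (hF₁ : F₁ ∈ Pl) (hF₂ : F₂ ∈ Pl) (hFne : F₁ ≠ F₂)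
    (a : ℝ) (ha : dist F₁ F₂ < 2 * a)
    (E : Set (EuclideanSpace ℝ (Fin 3)))
    (hE : E = {P | P ∈ Pl ∧ dist P F₁ + dist P F₂ = 2 * a})
    (e : ℝ) (he : e = dist F₁ F₂ / (2 * a))
    (O : EuclideanSpace ℝ (Fin 3)) (hO : O = midpoint ℝ F₁ F₂) :
    Set.ncard {C : Set (EuclideanSpace ℝ (Fin 3)) |
        IsCylinder C ∧ C ∩ (Pl : Set (EuclideanSpace ℝ (Fin 3))) = E} = 2 ∧
    ∀ C : Set (EuclideanSpace ℝ (Fin 3)),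
      IsCylinder C → C ∩ (Pl : Set (EuclideanSpace ℝ (Fin 3))) = E →
      ∃ (v : EuclideanSpace ℝ (Fin 3)) (w : ℝ), ‖v‖ = 1 ∧ 0 < w ∧ C = Cyl O v w ∧
        (∀ n : EuclideanSpace ℝ (Fin 3), ‖n‖ = 1 → n ∈ Pl.directionᗮ →
          AffineSubspace.mk' O (Submodule.span ℝ {v}) ≤
            AffineSubspace.mk' F₁ (Submodule.span ℝ {F₂ - F₁, n})) ∧
        |⟪v, F₂ - F₁⟫| = e * ‖F₂ - F₁‖ := by
  have hd : 0 < dist F₁ F₂ := dist_pos.2 hFne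
  obtain ⟨c, hc2⟩ : ∃ c, dist F₁ F₂ = 2 * c := ⟨dist F₁ F₂ / 2, by ring⟩
  have hc : 0 < c := by linarith
  have hca : c < a := by linarith
  have ha0 : 0 < a := hc.trans hca
  have hnorm : ‖F₂ - F₁‖ = 2 * c := by rw [← dist_eq_norm, dist_comm, hc2]
  have hec : e = c / a := by
    rw [he, hc2]
    field_simp
  have hpos : 0 < a ^ 2 - c ^ 2 := by nlinarith
  obtain ⟨b, hb, hbc⟩ : ∃ b : ℝ, 0 < b ∧ b ^ 2 = a ^ 2 - c ^ 2 :=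
    ⟨√(a ^ 2 - c ^ 2), Real.sqrt_pos.2 hpos, Real.sq_sqrt hpos.le⟩
  have hFD : F₂ - F₁ ∈ Pl.direction := AffineSubspace.vsub_mem_direction hF₂ hF₁
  obtain ⟨B, hB0, hspan, hD⟩ := exists_adapted_frame hPl
    (u := (2 * c)⁻¹ • (F₂ - F₁)) (Submodule.smul_mem _ _ hFD) (by
      rw [norm_smul, hnorm, norm_inv, Real.norm_of_nonneg (by positivity)]
      exact inv_mul_cancel₀ (by positivity))
  have hF : F₂ - F₁ = (2 * c) • B 0 := by
    rw [hB0, smul_inv_smul₀ (by positivity)]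
  have hOF₁ : O - F₁ = c • B 0 := by
    rw [hO, ← vsub_eq_sub, midpoint_vsub_left, vsub_eq_sub, hF, smul_smul]
    congr 1
    simp
  have hOF₂ : O - F₂ = -(c • B 0) := by
    rw [← sub_sub_sub_cancel_right O F₂ F₁, hOF₁, hF]
    module
  have hOPl : O ∈ Pl := by
    rw [hO]
    exact AffineMap.lineMap_mem _ hF₁ hF₂
  have hPl' : ∀ P, P ∈ Pl ↔ ⟪B 2, P - O⟫ = 0 := fun P => by
    rw [← hD, ← vsub_eq_sub, AffineSubspace.vsub_right_mem_direction_iff_mem hOPl]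
  have hE' : ∀ P, P ∈ E ↔ P ∈ Pl ∧
      b ^ 2 * ⟪B 0, P - O⟫ ^ 2 + a ^ 2 * ⟪B 1, P - O⟫ ^ 2 = a ^ 2 * b ^ 2 := by
    intro P
    rw [hE, Set.mem_ofPred_eq, hbc]
    refine and_congr_right fun hP => ?_
    have hP0 := (hPl' P).1 hP
    refine focal_sum_iff hc hca dist_nonneg dist_nonneg ?_ ?_
    · rw [dist_eq_norm, ← sub_add_sub_cancel P O F₁, hOF₁, norm_sq_eq_frame B]
      simp only [inner_add_right _ (P - O), inner_smul_right, inner_frame, hP0]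
      simp
    · rw [dist_eq_norm, ← sub_add_sub_cancel P O F₂, hOF₂, norm_sq_eq_frame B]
      simp only [inner_add_right _ (P - O), inner_neg_right, inner_smul_right, inner_frame, hP0]
      simp [sub_eq_add_neg]
  have hiff := isCylinder_and_inter_iff B hb hc hca hbc hPl' hE'
  have hunit : (c / a) ^ 2 + (b / a) ^ 2 = 1 := by
    field_simp
    linarith
  constructor
  · rw [Set.ncard_eq_two]
    exact ⟨_, _, Cyl_ne_Cyl_reflection B (by positivity) (by positivity) hunit hb,
      Set.ext hiff⟩
  · intro C hC hCE
    obtain ⟨s, hs, rfl⟩ : ∃ s : ℝ, s ^ 2 = (b / a) ^ 2 ∧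
        C = Cyl O ((c / a) • B 0 + s • B 2) b := by
      rcases (hiff C).1 ⟨hC, hCE⟩ with h | h
      · exact ⟨_, rfl, h⟩
      · exact ⟨_, neg_sq _, h⟩
    refine ⟨_, b, ?_, hb, rfl, ?_, ?_⟩
    · rw [← sq_eq_sq₀ (norm_nonneg _) zero_le_one, norm_sq_eq_frame B]
      simp [inner_add_right, inner_smul_right, hs, hunit]
    · intro n hn hnD
      rw [hspan, Submodule.mem_span_singleton] at hnD
      obtain ⟨t, rfl⟩ := hnD
      have ht : t ≠ 0 := by
        rintro rfl
        simp at hn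
      rw [hO]
      refine mk'_midpoint_le (Submodule.mem_span_pair.2 ⟨c / a * (2 * c)⁻¹, s * t⁻¹, ?_⟩)
      rw [hF, smul_smul, smul_smul, inv_mul_cancel_right₀ (by positivity),
        inv_mul_cancel_right₀ ht]
    · rw [hnorm, hF, hec, inner_eq_frame B]
      simp only [inner_add_right, inner_smul_right, inner_frame]
      simp
      rw [abs_of_pos (div_pos hc ha0), abs_of_pos hc]
end

section
/- Let E be a circle of radius ρ > 0 centered at Q lying in a plane Π of ℝ³. Then there is exactly one cylinder belonging to E (i.e., exactly one subset C of ℝ³ that is a cylinder with C ∩ Π = E), namely the cylinder of radius ρ whose axis is the line through Q perpendicular to Π. -/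
open scoped RealInnerProductSpace

theorem Metric.infDist_affineSubspace_mk' {V : Type*} [NormedAddCommGroup V]
    [InnerProductSpace ℝ V] (S : Submodule ℝ V) [S.HasOrthogonalProjection] (P Q : V) :
    Metric.infDist P (AffineSubspace.mk' Q S : Set V) = ‖Sᗮ.starProjection (P - Q)‖ := by
  apply le_antisymm
  · have hmem : Q + S.starProjection (P - Q) ∈ (AffineSubspace.mk' Q S : Set V) := by
      rw [SetLike.mem_coe, AffineSubspace.mem_mk', vsub_eq_sub, add_sub_cancel_left]
      exact S.starProjection_apply_mem _
    refine (Metric.infDist_le_dist_of_mem hmem).trans_eq ?_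
    rw [Submodule.starProjection_orthogonal_val, dist_eq_norm, sub_add_eq_sub_sub]
  · refine (Metric.le_infDist (AffineSubspace.mk'_nonempty Q S)).2 fun R hR ↦ ?_
    have hRQ : R - Q ∈ S := by simpa [AffineSubspace.mem_mk'] using hR
    have hproj : Sᗮ.starProjection (P - Q) = Sᗮ.starProjection (P - R) := by
      rw [← sub_add_sub_cancel P R Q, map_add,
        Submodule.starProjection_orthogonal_apply_eq_zero hRQ, add_zero]
    rw [hproj, dist_eq_norm]
    exact Sᗮ.norm_starProjection_apply_le _

/-- If projecting along `S` sends a sphere of `D`, translated by `a`, into a sphere about the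
origin, and `D` contains a nonzero vector orthogonal to `S`, then the whole of `D` is
orthogonal to `S` and to the projection of `a`, and the radii are related by Pythagoras. -/
theorem Submodule.le_orthogonal_of_norm_starProjection_eq {V : Type*} [NormedAddCommGroup V]
    [InnerProductSpace ℝ V] {S D : Submodule ℝ V} [S.HasOrthogonalProjection]
    (hSD : D ⊓ Sᗮ ≠ ⊥) {a : V} {ρ w : ℝ} (hρ : 0 < ρ)
    (h : ∀ x ∈ D, ‖x‖ = ρ → ‖Sᗮ.starProjection (a + x)‖ = w) :
    D ≤ Sᗮ ∧ Sᗮ.starProjection a ∈ Dᗮ ∧ ‖Sᗮ.starProjection a‖ ^ 2 + ρ ^ 2 = w ^ 2 := by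
  set T := Sᗮ.starProjection
  have hsphere : ∀ x ∈ D, ‖x‖ = ρ → ⟪T a, T x⟫ = 0 ∧ ‖T a‖ ^ 2 + ‖T x‖ ^ 2 = w ^ 2 := by
    intro x hx hxρ
    have hpos := h x hx hxρ
    have hneg := h (-x) (D.neg_mem hx) (by rwa [norm_neg])
    rw [map_add] at hpos
    rw [map_add, map_neg, ← sub_eq_add_neg] at hneg
    have hadd := norm_add_sq_real (T a) (T x)
    have hsub := norm_sub_sq_real (T a) (T x)
    rw [hpos] at hadd
    rw [hneg] at hsub
    constructor <;> linarith
  have hscale : ∀ x : V, x ≠ 0 → ‖(ρ / ‖x‖) • x‖ = ρ := by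
    intro x hx
    rw [norm_smul, Real.norm_of_nonneg (by positivity), div_mul_cancel₀ _ (norm_ne_zero_iff.2 hx)]
  obtain ⟨y, ⟨hyD, hyS⟩, hy0⟩ := Submodule.exists_mem_ne_zero_of_ne_bot hSD
  have hrad : ‖T a‖ ^ 2 + ρ ^ 2 = w ^ 2 := by
    have := (hsphere _ (D.smul_mem (ρ / ‖y‖) hyD) (hscale y hy0)).2
    rwa [Submodule.norm_starProjection_apply _ (Sᗮ.smul_mem _ hyS), hscale y hy0] at this
  have hle : D ≤ Sᗮ := by
    intro x hx
    by_cases hx0 : x = 0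
    · simp [hx0]
    have hx' := (hsphere _ (D.smul_mem (ρ / ‖x‖) hx) (hscale x hx0)).2
    have hmem : (ρ / ‖x‖) • x ∈ Sᗮ := by
      rw [Submodule.mem_iff_norm_starProjection, hscale x hx0,
        ← sq_eq_sq₀ (norm_nonneg _) hρ.le]
      linarith
    exact (Submodule.smul_mem_iff _ (div_ne_zero hρ.ne' (norm_ne_zero_iff.2 hx0))).1 hmem
  refine ⟨hle, (Submodule.mem_orthogonal' _ _).2 fun x hx ↦ ?_, hrad⟩
  by_cases hx0 : x = 0
  · simp [hx0]
  have hx' := (hsphere _ (D.smul_mem (ρ / ‖x‖) hx) (hscale x hx0)).1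
  rw [map_smul, real_inner_smul_right, Submodule.starProjection_eq_self_iff.2 (hle hx)] at hx'
  exact (mul_eq_zero.1 hx').resolve_left (div_ne_zero hρ.ne' (norm_ne_zero_iff.2 hx0))

/-- There is exactly one cylinder belonging to a circle `E` of radius `ρ` about `Q` in a
plane `Π`: the cylinder of radius `ρ` whose axis is the line through `Q` perpendicular
to `Π`. -/
theorem unique_cylinder_of_circle
    (Pl : AffineSubspace ℝ (EuclideanSpace ℝ (Fin 3)))
    (hPl : Module.finrank ℝ Pl.direction = 2)
    (Q : EuclideanSpace ℝ (Fin 3)) (hQ : Q ∈ Pl)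
    (ρ : ℝ) (hρ : 0 < ρ)
    (E : Set (EuclideanSpace ℝ (Fin 3)))
    (hE : E = {P | P ∈ Pl ∧ dist P Q = ρ}) :
    ∀ C : Set (EuclideanSpace ℝ (Fin 3)),
      (IsCylinder C ∧ C ∩ (Pl : Set (EuclideanSpace ℝ (Fin 3))) = E) ↔
        C = {P | Metric.infDist P
          (AffineSubspace.mk' Q Pl.directionᗮ : Set (EuclideanSpace ℝ (Fin 3))) = ρ} := by
  have hfin : Module.finrank ℝ (EuclideanSpace ℝ (Fin 3)) = 3 := by simp
  have hPlane : {P | Metric.infDist P (AffineSubspace.mk' Q Pl.directionᗮ :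
      Set (EuclideanSpace ℝ (Fin 3))) = ρ} ∩ (Pl : Set (EuclideanSpace ℝ (Fin 3))) = E := by
    ext P
    rw [hE, Set.mem_inter_iff, and_comm]
    refine and_congr_right fun hP ↦ ?_
    rw [Set.mem_ofPred_eq, Metric.infDist_affineSubspace_mk', dist_eq_norm,
      Submodule.norm_starProjection_apply]
    rw [Submodule.orthogonal_orthogonal]
    exact AffineSubspace.vsub_mem_direction hP hQ
  intro C
  constructor
  · rintro ⟨⟨A, v, w, hv, hw, rfl⟩, hC⟩
    unfold Cyl at hC ⊢
    set S := Submodule.span ℝ {v}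
    have hS : Module.finrank ℝ S = 1 := finrank_span_singleton hv
    have hSo : Module.finrank ℝ Sᗮ = 2 := by
      have := S.finrank_add_finrank_orthogonal
      omega
    have hne : Pl.direction ⊓ Sᗮ ≠ ⊥ := by
      intro hbot
      have h := Submodule.finrank_sup_add_finrank_inf_eq Pl.direction Sᗮ
      rw [hbot, finrank_bot] at h
      have := Submodule.finrank_le (Pl.direction ⊔ Sᗮ)
      omega
    have hcircle : ∀ x ∈ Pl.direction, ‖x‖ = ρ → ‖Sᗮ.starProjection (Q - A + x)‖ = w := by
      intro x hx hxρ
      have hxE : x + Q ∈ E := by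
        rw [hE]
        exact ⟨AffineSubspace.vadd_mem_of_mem_direction hx hQ, by simpa using hxρ⟩
      rw [← hC] at hxE
      have := hxE.1
      rwa [Set.mem_ofPred_eq, Metric.infDist_affineSubspace_mk', add_sub_assoc, add_comm] at this
    obtain ⟨hle, horth, hrad⟩ :=
      Submodule.le_orthogonal_of_norm_starProjection_eq hne hρ hcircle
    have hD : Pl.direction = Sᗮ := Submodule.eq_of_le_of_finrank_eq hle (hPl.trans hSo.symm)
    have hzero : Sᗮ.starProjection (Q - A) = 0 := by
      refine inner_self_eq_zero.1 ((Submodule.mem_orthogonal' _ _).1 horth _ ?_)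
      rw [hD]
      exact Submodule.starProjection_apply_mem _ _
    have hwρ : w = ρ := by
      rw [hzero, norm_zero, zero_pow two_ne_zero, zero_add, sq_eq_sq₀ hρ.le hw.le] at hrad
      exact hrad.symm
    ext P
    rw [Set.mem_ofPred_eq, Set.mem_ofPred_eq, hD, Submodule.orthogonal_orthogonal,
      Metric.infDist_affineSubspace_mk', Metric.infDist_affineSubspace_mk',
      ← sub_add_sub_cancel P Q A, map_add, hzero, add_zero, hwρ]
  · rintro rfl
    refine ⟨?_, hPlane⟩
    have hone : Module.finrank ℝ Pl.directionᗮ = 1 := by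
      have := Pl.direction.finrank_add_finrank_orthogonal
      omega
    obtain ⟨v, hv, hspan⟩ :=
      (atom_iff_nonzero_span _).1 (Submodule.isAtom_iff_finrank_eq_one.2 hone)
    exact ⟨Q, v, ρ, hv, hρ, by rw [Cyl, hspan]⟩
end

section
/- (A priori bounds.) Under the Kepler hypotheses with 𝐥 ≠ 0 and h < 0, for every t ∈ ℝ the position and momentum magnitudes satisfy l²/(2m²k) < ‖r(t)‖ < mk/(−h) and l·(−h)/(mk) < m‖ṙ(t)‖ < 2m²k/l. -/
open scoped RealInnerProductSpace

/-- Cross product on `EuclideanSpace ℝ (Fin 3)`. -/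
noncomputable def cross3 (v w : EuclideanSpace ℝ (Fin 3)) : EuclideanSpace ℝ (Fin 3) :=
  (EuclideanSpace.equiv (Fin 3) ℝ).symm
    (crossProduct ((EuclideanSpace.equiv (Fin 3) ℝ) v) ((EuclideanSpace.equiv (Fin 3) ℝ) w))

/-- Lagrange's identity for `cross3`. -/
theorem norm_sq_cross3 (v w : EuclideanSpace ℝ (Fin 3)) :
    ‖cross3 v w‖ ^ 2 = ‖v‖ ^ 2 * ‖w‖ ^ 2 - ⟪v, w⟫ ^ 2 := by
  simp only [EuclideanSpace.norm_sq_eq, PiLp.inner_apply, Fin.sum_univ_three, cross3,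
    cross_apply, Real.norm_eq_abs, sq_abs]
  simp
  ring

section CentralMotion

variable {E : Type*} [NormedAddCommGroup E] [InnerProductSpace ℝ E] {r : ℝ → E}

theorem eq_initial_of_hasDerivAt_zero {f : ℝ → ℝ} (hf : ∀ t, HasDerivAt f 0 t) (t : ℝ) :
    f t = f 0 :=
  is_const_of_deriv_eq_zero (fun s => (hf s).differentiableAt) (fun s => (hf s).deriv) t 0

/-- The squared area swept per unit time (up to a constant factor) is conserved under a
central force. -/
theorem central_motion_areal_conservation (c : ℝ → ℝ)
    (hr : Differentiable ℝ r) (hr' : Differentiable ℝ (deriv r))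
    (heq : ∀ t, deriv (deriv r) t = -c t • r t) (t : ℝ) :
    ‖r t‖ ^ 2 * ‖deriv r t‖ ^ 2 - ⟪r t, deriv r t⟫ ^ 2 =
      ‖r 0‖ ^ 2 * ‖deriv r 0‖ ^ 2 - ⟪r 0, deriv r 0⟫ ^ 2 := by
  refine eq_initial_of_hasDerivAt_zero
    (f := fun t => ‖r t‖ ^ 2 * ‖deriv r t‖ ^ 2 - ⟪r t, deriv r t⟫ ^ 2) (fun s => ?_) t
  have h1 := (hr s).hasDerivAt
  have h2 := (hr' s).hasDerivAt
  rw [heq s] at h2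
  refine HasDerivAt.congr_deriv ((h1.norm_sq.mul h2.norm_sq).sub ((h1.inner ℝ h2).pow 2)) ?_
  simp only [inner_smul_right, real_inner_self_eq_norm_sq, real_inner_comm (r s) (deriv r s)]
  push_cast
  ring

/-- The energy per unit mass is conserved along Kepler motions. -/
theorem kepler_energy_conservation (k : ℝ)
    (hr : Differentiable ℝ r) (hr' : Differentiable ℝ (deriv r)) (hrne : ∀ t, r t ≠ 0)
    (heq : ∀ t, deriv (deriv r) t = -(k / ‖r t‖ ^ 3) • r t) (t : ℝ) :
    ‖deriv r t‖ ^ 2 / 2 - k / ‖r t‖ = ‖deriv r 0‖ ^ 2 / 2 - k / ‖r 0‖ := by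
  refine eq_initial_of_hasDerivAt_zero
    (f := fun t => ‖deriv r t‖ ^ 2 / 2 - k / ‖r t‖) (fun s => ?_) t
  have h1 := (hr s).hasDerivAt
  have h2 := (hr' s).hasDerivAt
  rw [heq s] at h2
  have hn : ‖r s‖ ≠ 0 := norm_ne_zero_iff.2 (hrne s)
  have h3 : HasDerivAt (fun t => ‖r t‖) (⟪r s, deriv r s⟫ / ‖r s‖) s := by
    have := h1.norm_sq.sqrt (pow_ne_zero 2 hn)
    simp only [Real.sqrt_sq (norm_nonneg _)] at this
    convert this using 1
    field_simp
  refine HasDerivAt.congr_deriv ((h2.norm_sq.div_const 2).sub ((hasDerivAt_const s k).div h3 hn)) ?_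
  simp only [inner_smul_right, real_inner_comm (r s) (deriv r s)]
  field_simp
  ring

end CentralMotion

/-- A priori bounds on the radius and momentum for negative-energy Kepler orbits
with nonzero angular momentum. -/
theorem kepler_apriori_bounds
    (k m : ℝ) (hk : 0 < k) (hm : 0 < m)
    (r : ℝ → EuclideanSpace ℝ (Fin 3))
    (hr : Differentiable ℝ r) (hr' : Differentiable ℝ (deriv r))
    (hrne : ∀ t, r t ≠ 0)
    (heq : ∀ t, deriv (deriv r) t = -(k / ‖r t‖ ^ 3) • r t)
    (L : EuclideanSpace ℝ (Fin 3)) (hL : L = m • cross3 (r 0) (deriv r 0)) (hLne : L ≠ 0)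
    (l : ℝ) (hl : l = ‖L‖)
    (h : ℝ) (hh : h = m * ‖deriv r 0‖ ^ 2 / 2 - m * k / ‖r 0‖) (hhneg : h < 0)
    (t : ℝ) :
    l ^ 2 / (2 * m ^ 2 * k) < ‖r t‖ ∧ ‖r t‖ < m * k / (-h) ∧
      l * (-h) / (m * k) < m * ‖deriv r t‖ ∧ m * ‖deriv r t‖ < 2 * m ^ 2 * k / l := by
  have hρ : 0 < ‖r t‖ := norm_pos_iff.2 (hrne t)
  have hl0 : 0 < l := hl ▸ norm_pos_iff.2 hLne
  have hLsq : l ^ 2 = m ^ 2 * (‖r t‖ ^ 2 * ‖deriv r t‖ ^ 2 - ⟪r t, deriv r t⟫ ^ 2) := by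
    rw [central_motion_areal_conservation (fun t => k / ‖r t‖ ^ 3) hr hr' heq t,
      ← norm_sq_cross3, hl, hL, norm_smul, mul_pow, Real.norm_eq_abs, sq_abs]
  have hE : h = m * (‖deriv r t‖ ^ 2 / 2 - k / ‖r t‖) := by
    rw [kepler_energy_conservation k hr hr' hrne heq t, hh]
    ring
  have hv0 : 0 ≤ ‖deriv r t‖ := norm_nonneg _
  generalize ‖r t‖ = ρ at *
  generalize ‖deriv r t‖ = v at *
  have hle : l ≤ m * ρ * v := by
    refine (sq_le_sq₀ hl0.le (by positivity)).1 ?_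
    nlinarith [mul_nonneg (sq_nonneg m) (sq_nonneg ⟪r t, deriv r t⟫)]
  have hv : 0 < v := by
    rcases hv0.eq_or_lt with h0 | h0
    · simp [← h0] at hle
      linarith
    · exact h0
  have hEρ : h * ρ = m * (ρ * v ^ 2 / 2 - k) := by
    rw [hE]
    field_simp
  have hkin : ρ * v ^ 2 < 2 * k := by
    have : m * (ρ * v ^ 2 / 2 - k) < 0 := hEρ ▸ mul_neg_of_neg_of_pos hhneg hρ
    linarith [(pos_iff_neg_of_mul_neg this).1 hm]
  have hupper : ρ * -h < m * k := by
    have : 0 < m * (ρ * v ^ 2 / 2) := by positivity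
    linarith
  refine ⟨?_, ?_, ?_, ?_⟩
  · rw [div_lt_iff₀ (by positivity)]
    calc l ^ 2 ≤ (m * ρ * v) ^ 2 := by gcongr
      _ = m ^ 2 * ρ * (ρ * v ^ 2) := by ring
      _ < m ^ 2 * ρ * (2 * k) := by gcongr
      _ = ρ * (2 * m ^ 2 * k) := by ring
  · rwa [lt_div_iff₀ (by linarith)]
  · rw [div_lt_iff₀ (by positivity)]
    calc l * -h ≤ m * ρ * v * -h := by gcongr; linarith
      _ = m * v * (ρ * -h) := by ring
      _ < m * v * (m * k) := by gcongr
  · rw [lt_div_iff₀ hl0]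
    calc m * v * l ≤ m * v * (m * ρ * v) := by gcongr
      _ = m ^ 2 * (ρ * v ^ 2) := by ring
      _ < m ^ 2 * (2 * k) := by gcongr
      _ = 2 * m ^ 2 * k := by ring
end

section
/- (Virial theorem for the Kepler problem.) Under the Kepler hypotheses with 𝐥 ≠ 0 and h < 0, let T(t) = m‖ṙ(t)‖²/2 and V(t) = −mk/‖r(t)‖ be the kinetic and potential energies. Then the time averages exist: (1/t)∫₀ᵗ T(s) ds → −h and (1/t)∫₀ᵗ V(s) ds → 2h as t → ∞. -/
open scoped RealInnerProductSpace Topology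

section Kepler

variable {E : Type*} [NormedAddCommGroup E] [InnerProductSpace ℝ E]

/-- If `f = F' + c` is continuous and `F` is bounded, then the time average of `f` tends to `c`. -/
theorem tendsto_average_of_hasDerivAt_of_bounded {F f : ℝ → ℝ} {c C : ℝ}
    (hf : Continuous f) (hF : ∀ t, HasDerivAt F (f t - c) t) (hC : ∀ t, |F t| ≤ C) :
    Filter.Tendsto (fun t : ℝ => (1 / t) * ∫ s in (0:ℝ)..t, f s) Filter.atTop (𝓝 c) := by
  have hint (t : ℝ) : ∫ s in (0:ℝ)..t, f s = F t - F 0 + c * t := by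
    have h₁ := intervalIntegral.integral_eq_sub_of_hasDerivAt (a := 0) (b := t)
      (fun s _ => hF s) ((hf.sub continuous_const).intervalIntegrable 0 t)
    rw [intervalIntegral.integral_sub (hf.intervalIntegrable 0 t)
      (continuous_const.intervalIntegrable 0 t), intervalIntegral.integral_const] at h₁
    simp only [sub_zero, smul_eq_mul] at h₁
    linarith
  have hzero : Filter.Tendsto (fun t : ℝ => t⁻¹ * (F t - F 0)) Filter.atTop (𝓝 0) := by
    refine squeeze_zero_norm' (a := fun t => t⁻¹ * (2 * C)) ?_ ?_
    · filter_upwards [Filter.eventually_gt_atTop 0] with t ht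
      rw [norm_mul, Real.norm_of_nonneg (inv_nonneg.2 ht.le), Real.norm_eq_abs]
      gcongr
      linarith [abs_sub (F t) (F 0), hC t, hC 0]
    · simpa using tendsto_inv_atTop_zero.mul_const (2 * C)
  refine (by simpa using hzero.add_const c :
    Filter.Tendsto (fun t : ℝ => t⁻¹ * (F t - F 0) + c) Filter.atTop (𝓝 c)).congr' ?_
  filter_upwards [Filter.eventually_gt_atTop 0] with t ht
  rw [hint]
  field_simp

/-- Conservation of energy along solutions of Kepler's equation. -/
theorem kepler_energy_eq {k : ℝ} {r : ℝ → E} (m : ℝ)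
    (hr : Differentiable ℝ r) (hr' : Differentiable ℝ (deriv r)) (hrne : ∀ t, r t ≠ 0)
    (heq : ∀ t, deriv (deriv r) t = -(k / ‖r t‖ ^ 3) • r t) (t : ℝ) :
    m * ‖deriv r t‖ ^ 2 / 2 - m * k / ‖r t‖ = m * ‖deriv r 0‖ ^ 2 / 2 - m * k / ‖r 0‖ := by
  have hd (t : ℝ) : HasDerivAt (fun t => m * ‖deriv r t‖ ^ 2 / 2 - m * k / ‖r t‖) 0 t := by
    have hpos : 0 < ‖r t‖ := norm_pos_iff.2 (hrne t)
    have h₁ := ((hr' t).hasDerivAt.norm_sq.const_mul m).div_const 2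
    have h₂ : HasDerivAt (fun t => ‖r t‖) (⟪r t, deriv r t⟫ / ‖r t‖) t := by
      have := (hr t).hasDerivAt.norm_sq.sqrt (by positivity)
      simp only [Real.sqrt_sq (norm_nonneg _)] at this
      convert this using 1
      field_simp
    refine (h₁.sub ((hasDerivAt_const t (m * k)).div h₂ hpos.ne')).congr_deriv ?_
    rw [heq, inner_smul_right, real_inner_comm]
    field_simp
    ring
  exact is_const_of_deriv_eq_zero (fun t => (hd t).differentiableAt) (fun t => (hd t).deriv) t 0

/-- The virial `⟪r, ṙ⟫` along solutions of Kepler's equation. -/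
theorem hasDerivAt_kepler_virial {k : ℝ} {r : ℝ → E}
    (hr : Differentiable ℝ r) (hr' : Differentiable ℝ (deriv r)) (hrne : ∀ t, r t ≠ 0)
    (heq : ∀ t, deriv (deriv r) t = -(k / ‖r t‖ ^ 3) • r t) (t : ℝ) :
    HasDerivAt (fun t => ⟪r t, deriv r t⟫) (‖deriv r t‖ ^ 2 - k / ‖r t‖) t := by
  have hpos : 0 < ‖r t‖ := norm_pos_iff.2 (hrne t)
  refine ((hr t).hasDerivAt.inner ℝ (hr' t).hasDerivAt).congr_deriv ?_
  rw [heq, inner_smul_right, real_inner_self_eq_norm_sq, real_inner_self_eq_norm_sq]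
  field_simp
  ring

/-- At negative energy `h` the virial is bounded in terms of `k`, `m` and `h`. -/
theorem abs_inner_le_of_kepler_energy_neg {k m h : ℝ} (hk : 0 < k) (hm : 0 < m) (hneg : h < 0)
    {x v : E} (hx : x ≠ 0) (hE : m * ‖v‖ ^ 2 / 2 - m * k / ‖x‖ = h) :
    |⟪x, v⟫| ≤ √(2 * k * (m * k / -h)) := by
  have hpos : 0 < ‖x‖ := norm_pos_iff.2 hx
  have hx_le : ‖x‖ ≤ m * k / -h := by
    rw [le_div_comm₀ hpos (neg_pos.2 hneg)]
    nlinarith [sq_nonneg ‖v‖]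
  have hv : ‖x‖ * ‖v‖ ^ 2 ≤ 2 * k := by
    have h₁ : m * ‖v‖ ^ 2 / 2 ≤ m * k / ‖x‖ := by linarith
    rw [le_div_iff₀ hpos] at h₁
    refine le_of_mul_le_mul_left ?_ hm
    linarith
  refine (abs_real_inner_le_norm x v).trans (Real.le_sqrt_of_sq_le ?_)
  calc (‖x‖ * ‖v‖) ^ 2 = ‖x‖ * ‖v‖ ^ 2 * ‖x‖ := by ring
    _ ≤ 2 * k * (m * k / -h) := by gcongr

end Kepler

/-- Virial theorem for the Kepler problem: the time averages of the kinetic energy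
`T = m‖ṙ‖²/2` and the potential energy `V = −mk/‖r‖` exist and equal `−h` and `2h`. -/
theorem kepler_virial_theorem
    (k m : ℝ) (hk : 0 < k) (hm : 0 < m)
    (r : ℝ → EuclideanSpace ℝ (Fin 3))
    (hr : Differentiable ℝ r) (hr' : Differentiable ℝ (deriv r))
    (hrne : ∀ t, r t ≠ 0)
    (heq : ∀ t, deriv (deriv r) t = -(k / ‖r t‖ ^ 3) • r t)
    (L : EuclideanSpace ℝ (Fin 3)) (hL : L = m • cross3 (r 0) (deriv r 0)) (hLne : L ≠ 0)
    (h : ℝ) (hh : h = m * ‖deriv r 0‖ ^ 2 / 2 - m * k / ‖r 0‖) (hhneg : h < 0) :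
    Filter.Tendsto (fun t : ℝ => (1 / t) * ∫ s in (0:ℝ)..t, m * ‖deriv r s‖ ^ 2 / 2)
      Filter.atTop (𝓝 (-h)) ∧
    Filter.Tendsto (fun t : ℝ => (1 / t) * ∫ s in (0:ℝ)..t, -(m * k / ‖r s‖))
      Filter.atTop (𝓝 (2 * h)) := by
  have hE (t : ℝ) : m * ‖deriv r t‖ ^ 2 / 2 - m * k / ‖r t‖ = h :=
    (kepler_energy_eq m hr hr' hrne heq t).trans hh.symm
  have hW := hasDerivAt_kepler_virial hr hr' hrne heq
  have hbd (c t : ℝ) : |c * ⟪r t, deriv r t⟫| ≤ |c| * √(2 * k * (m * k / -h)) := by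
    rw [abs_mul]
    gcongr
    exact abs_inner_le_of_kepler_energy_neg hk hm hhneg (hrne t) (hE t)
  have hW' (t : ℝ) : m * (‖deriv r t‖ ^ 2 - k / ‖r t‖) = m * ‖deriv r t‖ ^ 2 / 2 + h := by
    rw [← hE t]
    ring
  constructor
  · refine tendsto_average_of_hasDerivAt_of_bounded ?_ (fun t => ?_) (hbd m)
    · have := hr'.continuous
      fun_prop
    · refine ((hW t).const_mul m).congr_deriv ?_
      linarith [hW' t]
  · refine tendsto_average_of_hasDerivAt_of_bounded ?_ (fun t => ?_) (hbd (-m))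
    · exact (continuous_const.div hr.continuous.norm fun t => norm_ne_zero_iff.2 (hrne t)).neg
    · refine ((hW t).const_mul (-m)).congr_deriv ?_
      linarith [hW' t, hE t]
end

section
/- Under the Kepler hypotheses with 𝐥 ≠ 0 and h < 0, the virial γ(t) = m⟪ṙ(t), r(t)⟫ has time average zero: (1/t)∫₀ᵗ γ(s) ds → 0 as t → ∞. -/
open scoped RealInnerProductSpace Topology

section Kepler

variable {E : Type*} [NormedAddCommGroup E] [InnerProductSpace ℝ E] {r : ℝ → E}

/-- Derivative of the norm along a curve that avoids the origin. -/
theorem HasDerivAt.norm_of_ne_zero {v : E} {t : ℝ} (hr : HasDerivAt r v t) (h0 : r t ≠ 0) :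
    HasDerivAt (fun s => ‖r s‖) (⟪r t, v⟫ / ‖r t‖) t := by
  have h := hr.norm_sq.sqrt (pow_ne_zero 2 (norm_ne_zero_iff.mpr h0))
  simp only [Real.sqrt_sq (norm_nonneg _)] at h
  convert h using 1
  rw [mul_div_mul_left _ _ two_ne_zero]

/-- Conservation of energy (per unit mass) for the Kepler problem. -/
theorem kepler_energy_conserved {k : ℝ} (hr : Differentiable ℝ r)
    (hr' : Differentiable ℝ (deriv r)) (hrne : ∀ t, r t ≠ 0)
    (heq : ∀ t, deriv (deriv r) t = -(k / ‖r t‖ ^ 3) • r t) (t : ℝ) :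
    ‖deriv r t‖ ^ 2 / 2 - k / ‖r t‖ = ‖deriv r 0‖ ^ 2 / 2 - k / ‖r 0‖ := by
  have hder : ∀ s, HasDerivAt (fun u => ‖deriv r u‖ ^ 2 / 2 - k / ‖r u‖) 0 s := by
    intro s
    have hs : ‖r s‖ ≠ 0 := norm_ne_zero_iff.mpr (hrne s)
    have hkin := (hr' s).hasDerivAt.norm_sq.div_const 2
    have hpot := (((hr s).hasDerivAt.norm_of_ne_zero (hrne s)).fun_inv hs).const_mul k
    simp only [← div_eq_mul_inv] at hpot
    refine (hkin.sub hpot).congr_deriv ?_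
    rw [heq s, inner_smul_right, real_inner_comm (r s) (deriv r s)]
    field_simp
    ring
  exact is_const_of_deriv_eq_zero (fun s => (hder s).differentiableAt)
    (fun s => (hder s).deriv) t 0

/-- The integral of `⟪r', r⟫` is half the increment of `‖r‖ ^ 2`. -/
theorem integral_inner_deriv_self (hr : Differentiable ℝ r) (hc : Continuous (deriv r)) (t : ℝ) :
    ∫ s in (0:ℝ)..t, ⟪deriv r s, r s⟫ = (‖r t‖ ^ 2 - ‖r 0‖ ^ 2) / 2 := by
  have hder : ∀ s ∈ Set.uIcc 0 t,
      HasDerivAt (fun u => ‖r u‖ ^ 2 / 2) ⟪deriv r s, r s⟫ s := by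
    intro s _
    refine ((hr s).hasDerivAt.norm_sq.div_const 2).congr_deriv ?_
    rw [real_inner_comm]
    ring
  rw [intervalIntegral.integral_eq_sub_of_hasDerivAt hder
    ((hc.inner hr.continuous).intervalIntegrable 0 t)]
  ring

end Kepler

/-- The virial of Clausius `γ(t) = m⟪ṙ(t), r(t)⟫` has time average zero. -/
theorem kepler_virial_average_zero
    (k m : ℝ) (hk : 0 < k) (hm : 0 < m)
    (r : ℝ → EuclideanSpace ℝ (Fin 3))
    (hr : Differentiable ℝ r) (hr' : Differentiable ℝ (deriv r))
    (hrne : ∀ t, r t ≠ 0)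
    (heq : ∀ t, deriv (deriv r) t = -(k / ‖r t‖ ^ 3) • r t)
    (L : EuclideanSpace ℝ (Fin 3)) (hL : L = m • cross3 (r 0) (deriv r 0)) (hLne : L ≠ 0)
    (h : ℝ) (hh : h = m * ‖deriv r 0‖ ^ 2 / 2 - m * k / ‖r 0‖) (hhneg : h < 0) :
    Filter.Tendsto (fun t : ℝ => (1 / t) * ∫ s in (0:ℝ)..t, m * ⟪deriv r s, r s⟫)
      Filter.atTop (𝓝 0) := by
  have hbound : ∀ t, ‖r t‖ ≤ m * k / -h := by
    intro t
    have hpos : 0 < ‖r t‖ := norm_pos_iff.mpr (hrne t)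
    have henergy : h = m * ‖deriv r t‖ ^ 2 / 2 - m * k / ‖r t‖ := by
      rw [hh]
      linear_combination -m * kepler_energy_conserved hr hr' hrne heq t
    have hle : -h ≤ m * k / ‖r t‖ := by
      have : 0 ≤ m * ‖deriv r t‖ ^ 2 / 2 := by positivity
      linarith
    rw [le_div_iff₀ hpos] at hle
    rw [le_div_iff₀ (neg_pos.mpr hhneg)]
    linarith
  simp only [intervalIntegral.integral_const_mul, integral_inner_deriv_self hr hr'.continuous]
  have hinv : Filter.Tendsto (fun t : ℝ => 1 / t) Filter.atTop (𝓝 0) := by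
    simpa only [one_div] using tendsto_inv_atTop_zero (𝕜 := ℝ)
  refine hinv.zero_mul_isBoundedUnder_le
    (Filter.isBoundedUnder_of ⟨m * (m * k / -h) ^ 2, fun t => ?_⟩)
  have hsq : ∀ s, ‖r s‖ ^ 2 ≤ (m * k / -h) ^ 2 := fun s =>
    pow_le_pow_left₀ (norm_nonneg _) (hbound s) 2
  simp only [Function.comp_apply, Real.norm_eq_abs, abs_mul, abs_of_pos hm]
  refine mul_le_mul_of_nonneg_left (abs_le.mpr ⟨?_, ?_⟩) hm.le <;>
    linarith [hsq 0, hsq t, sq_nonneg ‖r 0‖, sq_nonneg ‖r t‖]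
end

section
/- Under the Kepler hypotheses with 𝐥 ≠ 0 and h < 0, the virial γ(t) = m⟪ṙ(t), r(t)⟫ vanishes for infinitely many t; that is, the set {t ∈ ℝ : ⟪ṙ(t), r(t)⟫ = 0} is infinite. -/
open scoped RealInnerProductSpace

/-- An integral of a continuous function bounded below by a positive constant maps onto `ℝ`. -/
theorem surjective_of_hasDerivAt_ge {θ w : ℝ → ℝ} {δ : ℝ} (hδ : 0 < δ)
    (hθ : ∀ t, HasDerivAt θ (w t) t) (hw : ∀ t, δ ≤ w t) : Function.Surjective θ := by
  have hmono : Monotone fun t => θ t - δ * t := by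
    have hd : ∀ t, HasDerivAt (fun t => θ t - δ * t) (w t - δ * 1) t := fun t =>
      (hθ t).sub ((hasDerivAt_id t).const_mul δ)
    refine monotone_of_deriv_nonneg (fun t => (hd t).differentiableAt) fun t => ?_
    rw [(hd t).deriv]
    linarith [hw t]
  have hcont : Continuous θ := continuous_iff_continuousAt.2 fun t => (hθ t).continuousAt
  intro y
  refine mem_range_of_exists_le_of_exists_ge hcont
    ⟨-(|y - θ 0| / δ), ?_⟩ ⟨|y - θ 0| / δ, ?_⟩
  · have h₁ := hmono (show -(|y - θ 0| / δ) ≤ 0 by simp only [Left.neg_nonpos_iff]; positivity)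
    have h₂ : δ * -(|y - θ 0| / δ) = -|y - θ 0| := by field_simp
    simp only [h₂] at h₁
    linarith [neg_abs_le (y - θ 0)]
  · have h₁ := hmono (show 0 ≤ |y - θ 0| / δ by positivity)
    have h₂ : δ * (|y - θ 0| / δ) = |y - θ 0| := by field_simp
    simp only [h₂] at h₁
    linarith [le_abs_self (y - θ 0)]

/-- A linear combination of `cos` and `sin` has infinitely many zeros. -/
theorem infinite_zeros_cos_sub_sin (P Q : ℝ) :
    {s : ℝ | P * Real.cos s - Q * Real.sin s = 0}.Infinite := by
  obtain ⟨s, hs⟩ : ∃ s, P * Real.cos s - Q * Real.sin s = 0 := by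
    have hc : Continuous fun s => P * Real.cos s - Q * Real.sin s := by fun_prop
    rcases le_total P 0 with hP | hP
    · exact mem_range_of_exists_le_of_exists_ge hc ⟨0, by simpa⟩ ⟨Real.pi, by simpa⟩
    · exact mem_range_of_exists_le_of_exists_ge hc ⟨Real.pi, by simpa⟩ ⟨0, by simpa⟩
  refine Set.infinite_of_injective_forall_mem (f := fun n : ℕ => s + n * Real.pi) ?_ fun n => ?_
  · intro a b hab
    simpa [Real.pi_ne_zero] using hab
  · rw [Set.mem_ofPred_eq, Real.cos_add_nat_mul_pi, Real.sin_add_nat_mul_pi]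
    linear_combination (-1) ^ n * hs

/-- A component of a planar vector rotating with angular velocity bounded below by a positive
constant vanishes infinitely often. -/
theorem infinite_zeros_of_rotation {g x w : ℝ → ℝ} {δ : ℝ} (hδ : 0 < δ)
    (hwc : Continuous w) (hw : ∀ t, δ ≤ w t)
    (hg : ∀ t, HasDerivAt g (-(w t * x t)) t) (hx : ∀ t, HasDerivAt x (w t * g t) t) :
    {t : ℝ | g t = 0}.Infinite := by
  let θ : ℝ → ℝ := fun t => ∫ s in (0 : ℝ)..t, w s
  have hθ : ∀ t, HasDerivAt θ (w t) t := fun t => (hwc.integral_hasStrictDerivAt 0 t).hasDerivAt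
  let P : ℝ → ℝ := fun t => g t * Real.cos (θ t) + x t * Real.sin (θ t)
  let Q : ℝ → ℝ := fun t => x t * Real.cos (θ t) - g t * Real.sin (θ t)
  have hP : ∀ t, HasDerivAt P 0 t := fun t =>
    (((hg t).mul (hθ t).cos).add ((hx t).mul (hθ t).sin)).congr_deriv (by ring)
  have hQ : ∀ t, HasDerivAt Q 0 t := fun t =>
    (((hx t).mul (hθ t).cos).sub ((hg t).mul (hθ t).sin)).congr_deriv (by ring)
  have hPc : ∀ t, P t = P 0 := fun t => is_const_of_deriv_eq_zero
    (fun t => (hP t).differentiableAt) (fun t => (hP t).deriv) t 0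
  have hQc : ∀ t, Q t = Q 0 := fun t => is_const_of_deriv_eq_zero
    (fun t => (hQ t).differentiableAt) (fun t => (hQ t).deriv) t 0
  have hgθ : ∀ t, g t = P 0 * Real.cos (θ t) - Q 0 * Real.sin (θ t) := fun t => by
    rw [← hPc t, ← hQc t]
    linear_combination -(g t) * Real.sin_sq_add_cos_sq (θ t)
  have hpre : {t : ℝ | g t = 0} = θ ⁻¹' {s | P 0 * Real.cos s - Q 0 * Real.sin s = 0} := by
    ext t
    simp [hgθ t]
  rw [hpre]
  exact (infinite_zeros_cos_sub_sin _ _).preimage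
    (by simp [(surjective_of_hasDerivAt_ge hδ hθ hw).range_eq])

/-- The virial `γ(t) = m⟪ṙ(t), r(t)⟫` vanishes for infinitely many times `t`. -/
theorem kepler_virial_vanishes_infinitely_often
    (k m : ℝ) (hk : 0 < k) (hm : 0 < m)
    (r : ℝ → EuclideanSpace ℝ (Fin 3))
    (hr : Differentiable ℝ r) (hr' : Differentiable ℝ (deriv r))
    (hrne : ∀ t, r t ≠ 0)
    (heq : ∀ t, deriv (deriv r) t = -(k / ‖r t‖ ^ 3) • r t)
    (L : EuclideanSpace ℝ (Fin 3)) (hL : L = m • cross3 (r 0) (deriv r 0)) (hLne : L ≠ 0)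
    (h : ℝ) (hh : h = m * ‖deriv r 0‖ ^ 2 / 2 - m * k / ‖r 0‖) (hhneg : h < 0) :
    {t : ℝ | ⟪deriv r t, r t⟫ = 0}.Infinite := by
  have hρ : ∀ t, 0 < ‖r t‖ := fun t => norm_pos_iff.2 (hrne t)
  have hdr : ∀ t, HasDerivAt r (deriv r t) t := fun t => (hr t).hasDerivAt
  have hdv : ∀ t, HasDerivAt (deriv r) (-(k / ‖r t‖ ^ 3) • r t) t := fun t =>
    heq t ▸ (hr' t).hasDerivAt
  have hdρ : ∀ t, HasDerivAt (fun t => ‖r t‖) (⟪deriv r t, r t⟫ / ‖r t‖) t := fun t => by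
    have h₁ := (hdr t).norm_sq.sqrt (pow_ne_zero 2 (hρ t).ne')
    simp only [Real.sqrt_sq (norm_nonneg _)] at h₁
    refine h₁.congr_deriv ?_
    rw [real_inner_comm]
    field_simp [(hρ t).ne']
  set e : ℝ := h / m with he
  have he_neg : e < 0 := div_neg_of_neg_of_pos hhneg hm
  have henergy : ∀ t, ‖deriv r t‖ ^ 2 / 2 - k / ‖r t‖ = e := by
    have hd : ∀ t, HasDerivAt (fun t => ‖deriv r t‖ ^ 2 / 2 - k / ‖r t‖) 0 t := fun t => by
      refine (((hdv t).norm_sq.div_const 2).sub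
        ((hasDerivAt_const t k).div (hdρ t) (hρ t).ne')).congr_deriv ?_
      rw [inner_smul_right]
      have := (hρ t).ne'
      field_simp
      ring
    intro t
    rw [is_const_of_deriv_eq_zero (fun t => (hd t).differentiableAt) (fun t => (hd t).deriv) t 0,
      he, hh]
    field_simp
  have hdg : ∀ t, HasDerivAt (fun t => ⟪deriv r t, r t⟫) (2 * e + k / ‖r t‖) t := fun t => by
    refine ((hdv t).inner ℝ (hdr t)).congr_deriv ?_
    rw [inner_smul_left, real_inner_self_eq_norm_sq, real_inner_self_eq_norm_sq, ← henergy t]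
    have := (hρ t).ne'
    simp only [conj_trivial]
    field_simp
    ring
  have hω : 0 < √(-2 * e) := Real.sqrt_pos.2 (by linarith)
  have hω_sq : √(-2 * e) ^ 2 = -2 * e := Real.sq_sqrt (by linarith)
  have hbound : ∀ t, ‖r t‖ ≤ k / -e := fun t => by
    have h₁ : -e ≤ k / ‖r t‖ := by linarith [henergy t, sq_nonneg ‖deriv r t‖]
    rw [le_div_iff₀ (hρ t)] at h₁
    rw [le_div_iff₀ (neg_pos.2 he_neg)]
    linarith
  refine infinite_zeros_of_rotation (w := fun t => √(-2 * e) / ‖r t‖)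
    (x := fun t => √(-2 * e) * (‖r t‖ + k / (2 * e))) (δ := √(-2 * e) / (k / -e))
    (div_pos hω (div_pos hk (neg_pos.2 he_neg)))
    (continuous_const.div hr.continuous.norm fun t => (hρ t).ne')
    (fun t => div_le_div_of_nonneg_left hω.le (hρ t) (hbound t)) (fun t => ?_) fun t => ?_
  · refine (hdg t).congr_deriv ?_
    have h₁ : √(-2 * e) / ‖r t‖ * (√(-2 * e) * (‖r t‖ + k / (2 * e)))
        = √(-2 * e) ^ 2 * (‖r t‖ + k / (2 * e)) / ‖r t‖ := by ring
    rw [h₁, hω_sq]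
    have := (hρ t).ne'
    have := he_neg.ne
    field_simp
  · exact (((hdρ t).add_const _).const_mul _).congr_deriv (by ring)
end

section
/- (Kepler's equation.) Let w, S_x, c be real constants with c > 0 and |S_x| < w, and let φ : ℝ → ℝ be differentiable. Then φ(0) = 0 and φ′(t) = c/(w − S_x·cos φ(t)) for all t ∈ ℝ if and only if φ(t) − (S_x/w)·sin φ(t) = (c/w)·t for all t ∈ ℝ. -/
/-- Kepler's equation: a differentiable `φ : ℝ → ℝ` satisfies `φ(0) = 0` and
`φ′(t) = c/(w − S_x·cos φ(t))` for all `t` iff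
`φ(t) − (S_x/w)·sin φ(t) = (c/w)·t` for all `t`. -/
theorem kepler_equation
    (w Sx c : ℝ) (hw : 0 < w) (hSx : |Sx| < w) (hc : 0 < c)
    (φ : ℝ → ℝ) (hφ : Differentiable ℝ φ) :
    (φ 0 = 0 ∧ ∀ t, deriv φ t = c / (w - Sx * Real.cos (φ t))) ↔
      (∀ t, φ t - (Sx / w) * Real.sin (φ t) = (c / w) * t) := by
  have hpos : ∀ x, 0 < w - Sx * Real.cos x := fun x => by
    have h : |Sx * Real.cos x| ≤ |Sx| := by
      rw [abs_mul]
      exact mul_le_of_le_one_right (abs_nonneg _) (Real.abs_cos_le_one x)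
    linarith [le_abs_self (Sx * Real.cos x)]
  have hder : ∀ t, HasDerivAt (fun s => w * φ s - Sx * Real.sin (φ s) - c * s)
      ((w - Sx * Real.cos (φ t)) * deriv φ t - c) t := fun t => by
    have h := (hφ t).hasDerivAt
    exact (((h.const_mul w).sub (h.sin.const_mul Sx)).sub
      ((hasDerivAt_id' t).const_mul c)).congr_deriv (by ring)
  have hiff : ∀ t, φ t - (Sx / w) * Real.sin (φ t) = (c / w) * t ↔
      w * φ t - Sx * Real.sin (φ t) - c * t = 0 := fun t => by
    have h : φ t - (Sx / w) * Real.sin (φ t) - (c / w) * t =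
        (w * φ t - Sx * Real.sin (φ t) - c * t) / w := by
      field_simp
    rw [← sub_eq_zero, h, div_eq_zero_iff, or_iff_left hw.ne']
  simp only [hiff]
  constructor
  · rintro ⟨h0, hd⟩ t
    have hconst := is_const_of_deriv_eq_zero (fun s => (hder s).differentiableAt)
      (fun s => by rw [(hder s).deriv, hd s, mul_div_cancel₀ _ (hpos _).ne', sub_self]) t 0
    simpa [h0] using hconst
  · intro h
    refine ⟨?_, fun t => ?_⟩
    · have h1 : w * φ 0 = Sx * Real.sin (φ 0) := by linarith [h 0]
      have h2 : w * |φ 0| ≤ |Sx| * |φ 0| := by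
        rw [← abs_of_pos hw, ← abs_mul, h1, abs_mul]
        exact mul_le_mul_of_nonneg_left Real.abs_sin_le_abs (abs_nonneg _)
      by_contra hne
      exact absurd (le_of_mul_le_mul_right h2 (abs_pos.mpr hne)) hSx.not_ge
    · have h1 := hder t
      simp only [h] at h1
      have h2 := h1.unique (hasDerivAt_const t 0)
      rw [eq_div_iff (hpos _).ne']
      linarith
end

section
/- Let w > 0, S_x with 0 < |S_x| < w, S_z ∈ ℝ, λ > 0, and let u, z : ℝ → ℝ be functions satisfying, for all t ∈ ℝ, the relation λ²(w − u(t))² = w² + z(t)² − 2w·u(t) − 2S_z·z(t) + S_x² + S_z². Suppose z is affine in u, i.e. there exist constants a, b with z(t) = a·u(t) + b for all t, and suppose u takes at least three distinct values. Then λ = (1 − S_x²/w²)^(−1/2), and either z(t) − S_z = λ·(S_x²/w − u(t)) for all t, or z(t) − S_z = −λ·(S_x²/w − u(t)) for all t. -/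
/-- A real quadratic with three distinct roots has zero coefficients. -/
lemma quadratic_coeffs_eq_zero {A B C x y v : ℝ} (hxy : x ≠ y) (hyv : y ≠ v) (hxv : x ≠ v)
    (hx : A * x ^ 2 + B * x + C = 0) (hy : A * y ^ 2 + B * y + C = 0)
    (hv : A * v ^ 2 + B * v + C = 0) : A = 0 ∧ B = 0 ∧ C = 0 := by
  have h₁ : A * (x + y) + B = 0 :=
    mul_left_cancel₀ (sub_ne_zero.2 hxy) (by linear_combination hx - hy)
  have h₂ : A * (x + v) + B = 0 :=
    mul_left_cancel₀ (sub_ne_zero.2 hxv) (by linear_combination hx - hv)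
  have hA : A = 0 := mul_left_cancel₀ (sub_ne_zero.2 hyv) (by linear_combination h₁ - h₂)
  subst hA
  have hB : B = 0 := by linear_combination h₁
  subst hB
  exact ⟨rfl, rfl, by linear_combination hx⟩

/-- If `λ²(w − u)² = w² + z² − 2wu − 2S_z z + S_x² + S_z²` holds identically, `z` is an
affine function of `u`, and `u` takes at least three distinct values, then
`λ = (1 − S_x²/w²)^(−1/2)` and `z − S_z = ±λ·(S_x²/w − u)`. -/
theorem z_affine_in_u
    (w Sx Sz lam : ℝ) (hw : 0 < w) (hSx0 : 0 < |Sx|) (hSx : |Sx| < w) (hlam : 0 < lam)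
    (u z : ℝ → ℝ)
    (hrel : ∀ t, lam ^ 2 * (w - u t) ^ 2 =
      w ^ 2 + (z t) ^ 2 - 2 * w * u t - 2 * Sz * z t + Sx ^ 2 + Sz ^ 2)
    (a b : ℝ) (haff : ∀ t, z t = a * u t + b)
    (hthree : ∃ t₁ t₂ t₃, u t₁ ≠ u t₂ ∧ u t₂ ≠ u t₃ ∧ u t₁ ≠ u t₃) :
    lam = (1 - Sx ^ 2 / w ^ 2) ^ (-(1:ℝ)/2) ∧
      ((∀ t, z t - Sz = lam * (Sx ^ 2 / w - u t)) ∨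
       (∀ t, z t - Sz = -(lam * (Sx ^ 2 / w - u t)))) := by
  have hquad : ∀ t, (lam ^ 2 - a ^ 2) * u t ^ 2 +
      (2 * w - 2 * w * lam ^ 2 - 2 * a * (b - Sz)) * u t +
      (lam ^ 2 * w ^ 2 - w ^ 2 - Sx ^ 2 - (b - Sz) ^ 2) = 0 := by
    intro t
    have h := hrel t
    rw [haff t] at h
    linear_combination h
  obtain ⟨t₁, t₂, t₃, h₁₂, h₂₃, h₁₃⟩ := hthree
  obtain ⟨hA, hB, hC⟩ :=
    quadratic_coeffs_eq_zero h₁₂ h₂₃ h₁₃ (hquad t₁) (hquad t₂) (hquad t₃)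
  have hprod : a * (b - Sz) = w * (1 - lam ^ 2) := by linear_combination -hB / 2
  have hsq : lam ^ 2 * (w ^ 2 - Sx ^ 2) = w ^ 2 := by
    linear_combination (a * (b - Sz) + w * (1 - lam ^ 2)) * hprod + (b - Sz) ^ 2 * hA +
      lam ^ 2 * hC
  have hinv : 1 - Sx ^ 2 / w ^ 2 = lam ^ (-2 : ℝ) := by
    rw [Real.rpow_neg hlam.le, Real.rpow_two]
    field_simp
    linear_combination hsq
  refine ⟨?_, ?_⟩
  · rw [hinv, ← Real.rpow_mul hlam.le]
    norm_num
  · rcases sq_eq_sq_iff_eq_or_eq_neg.1 (sub_eq_zero.1 hA) with h | h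
    · obtain rfl : a = lam := h.symm
      right
      intro t
      rw [haff t]
      field_simp
      apply mul_left_cancel₀ hlam.ne'
      linear_combination w * hprod - hsq
    · obtain rfl : a = -lam := by linarith
      left
      intro t
      rw [haff t]
      field_simp
      apply mul_left_cancel₀ hlam.ne'
      linear_combination -w * hprod + hsq
end

section
/- (Kepler's first law, conic form.) Under the Kepler hypotheses with 𝐥 ≠ 0, let 𝐀 = A(0) be the Laplace–Runge–Lenz vector. Then for all t ∈ ℝ, ⟪𝐀, r(t)⟫ + m²k‖r(t)‖ = l²; that is, the orbit lies on a conic section with one focus at the origin. -/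
open scoped RealInnerProductSpace

theorem cross3_apply (v w : EuclideanSpace ℝ (Fin 3)) (i : Fin 3) :
    cross3 v w i = ![v 1 * w 2 - v 2 * w 1, v 2 * w 0 - v 0 * w 2, v 0 * w 1 - v 1 * w 0] i := by
  simp [cross3, cross_apply]

theorem cross3_self (v : EuclideanSpace ℝ (Fin 3)) : cross3 v v = 0 := by
  ext i
  fin_cases i <;> simp [cross3_apply] <;> ring

theorem cross3_smul_left (a : ℝ) (v w : EuclideanSpace ℝ (Fin 3)) :
    cross3 (a • v) w = a • cross3 v w := by
  simp [cross3]

theorem cross3_smul_right (a : ℝ) (v w : EuclideanSpace ℝ (Fin 3)) :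
    cross3 v (a • w) = a • cross3 v w := by
  simp [cross3]

theorem cross3_cross3_self (u v : EuclideanSpace ℝ (Fin 3)) :
    cross3 u (cross3 u v) = ⟪u, v⟫ • u - ‖u‖ ^ 2 • v := by
  ext i
  fin_cases i <;>
    simp [cross3_apply, PiLp.inner_apply, EuclideanSpace.real_norm_sq_eq, Fin.sum_univ_three] <;>
    ring

theorem inner_cross3_cross3 (u v : EuclideanSpace ℝ (Fin 3)) :
    ⟪cross3 v (cross3 u v), u⟫ = ‖cross3 u v‖ ^ 2 := by
  simp [cross3_apply, PiLp.inner_apply, EuclideanSpace.real_norm_sq_eq, Fin.sum_univ_three]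
  ring

theorem hasDerivAt_euclidean {ι : Type*} [Fintype ι] {f : ℝ → EuclideanSpace ℝ ι}
    {f' : EuclideanSpace ℝ ι} {t : ℝ} :
    HasDerivAt f f' t ↔ ∀ i, HasDerivAt (fun s => f s i) (f' i) t := by
  rw [← hasDerivAt_pi]
  constructor
  · intro h
    exact (EuclideanSpace.equiv ι ℝ).hasFDerivAt.comp_hasDerivAt t h
  · intro h
    exact (EuclideanSpace.equiv ι ℝ).symm.hasFDerivAt.comp_hasDerivAt t h

theorem HasDerivAt.cross3 {f g : ℝ → EuclideanSpace ℝ (Fin 3)}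
    {f' g' : EuclideanSpace ℝ (Fin 3)} {t : ℝ} (hf : HasDerivAt f f' t) (hg : HasDerivAt g g' t) :
    HasDerivAt (fun s => cross3 (f s) (g s)) (cross3 f' (g t) + cross3 (f t) g') t := by
  rw [hasDerivAt_euclidean] at hf hg ⊢
  intro i
  fin_cases i <;> simp only [cross3_apply, PiLp.add_apply]
  · exact (((hf 1).mul (hg 2)).sub ((hf 2).mul (hg 1))).congr_deriv (by simp; ring)
  · exact (((hf 2).mul (hg 0)).sub ((hf 0).mul (hg 2))).congr_deriv (by simp; ring)
  · exact (((hf 0).mul (hg 1)).sub ((hf 1).mul (hg 0))).congr_deriv (by simp; ring)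

theorem HasDerivAt.norm_of_ne_zero_s17 {E : Type*} [NormedAddCommGroup E] [InnerProductSpace ℝ E]
    {f : ℝ → E} {f' : E} {t : ℝ} (hf : HasDerivAt f f' t) (h0 : f t ≠ 0) :
    HasDerivAt (fun s => ‖f s‖) (⟪f t, f'⟫ / ‖f t‖) t := by
  have h := hf.norm_sq.sqrt (pow_ne_zero 2 (norm_ne_zero_iff.mpr h0))
  simp only [Real.sqrt_sq (norm_nonneg _)] at h
  exact h.congr_deriv (mul_div_mul_left _ _ two_ne_zero)

theorem eq_of_forall_hasDerivAt_zero {E : Type*} [NormedAddCommGroup E] [NormedSpace ℝ E]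
    {f : ℝ → E} (hf : ∀ t, HasDerivAt f 0 t) (s t : ℝ) : f s = f t :=
  is_const_of_deriv_eq_zero (fun t => (hf t).differentiableAt) (fun t => (hf t).deriv) s t

section Kepler

variable {k : ℝ} {r : ℝ → EuclideanSpace ℝ (Fin 3)}

theorem hasDerivAt_cross3_deriv_of_kepler (hr : Differentiable ℝ r)
    (hr' : Differentiable ℝ (deriv r))
    (heq : ∀ t, deriv (deriv r) t = -(k / ‖r t‖ ^ 3) • r t) (t : ℝ) :
    HasDerivAt (fun s => cross3 (r s) (deriv r s)) 0 t := by
  refine ((hr t).hasDerivAt.cross3 (hr' t).hasDerivAt).congr_deriv ?_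
  rw [heq, cross3_smul_right, cross3_self, cross3_self, smul_zero, add_zero]

/-- The Laplace–Runge–Lenz vector (for unit mass) is conserved. -/
theorem hasDerivAt_lrl_of_kepler (hr : Differentiable ℝ r)
    (hr' : Differentiable ℝ (deriv r)) (hrne : ∀ t, r t ≠ 0)
    (heq : ∀ t, deriv (deriv r) t = -(k / ‖r t‖ ^ 3) • r t) (t : ℝ) :
    HasDerivAt (fun s => cross3 (deriv r s) (cross3 (r s) (deriv r s)) - (k / ‖r s‖) • r s)
      0 t := by
  have hn : ‖r t‖ ≠ 0 := norm_ne_zero_iff.mpr (hrne t)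
  have hL := hasDerivAt_cross3_deriv_of_kepler hr hr' heq t
  have hρ := (hr t).hasDerivAt.norm_of_ne_zero_s17 (hrne t)
  refine (((hr' t).hasDerivAt.cross3 hL).sub
    (((hasDerivAt_const t k).div hρ hn).smul (hr t).hasDerivAt)).congr_deriv ?_
  have h0 : cross3 (deriv r t) 0 = 0 := by simp [cross3]
  rw [heq, cross3_smul_left, cross3_cross3_self, h0]
  simp only [Pi.div_apply]
  match_scalars <;> field_simp <;> ring

end Kepler

/-- Kepler's first law in conic form: `⟪𝐀, r(t)⟫ + m²k‖r(t)‖ = l²` for all `t`, i.e.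
the orbit lies on a conic section with one focus at the origin. -/
theorem kepler_first_law_conic
    (k m : ℝ) (hk : 0 < k) (hm : 0 < m)
    (r : ℝ → EuclideanSpace ℝ (Fin 3))
    (hr : Differentiable ℝ r) (hr' : Differentiable ℝ (deriv r))
    (hrne : ∀ t, r t ≠ 0)
    (heq : ∀ t, deriv (deriv r) t = -(k / ‖r t‖ ^ 3) • r t)
    (L : EuclideanSpace ℝ (Fin 3)) (hL : L = m • cross3 (r 0) (deriv r 0)) (hLne : L ≠ 0)
    (l : ℝ) (hl : l = ‖L‖)
    (A : EuclideanSpace ℝ (Fin 3))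
    (hA : A = cross3 (m • deriv r 0) (m • cross3 (r 0) (deriv r 0)) - (m ^ 2 * k / ‖r 0‖) • r 0)
    (t : ℝ) :
    ⟪A, r t⟫ + m ^ 2 * k * ‖r t‖ = l ^ 2 := by
  have hc := eq_of_forall_hasDerivAt_zero (hasDerivAt_cross3_deriv_of_kepler hr hr' heq) 0 t
  have hA' := eq_of_forall_hasDerivAt_zero (hasDerivAt_lrl_of_kepler hr hr' hrne heq) 0 t
  have hAt : A = m ^ 2 • (cross3 (deriv r t) (cross3 (r t) (deriv r t)) - (k / ‖r t‖) • r t) := by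
    rw [← hA', hA, cross3_smul_left, cross3_smul_right]
    module
  have hn : ‖r t‖ ≠ 0 := norm_ne_zero_iff.mpr (hrne t)
  rw [hl, hL, hc, hAt, norm_smul, mul_pow, Real.norm_eq_abs, sq_abs, inner_smul_left,
    inner_sub_left, inner_smul_left, inner_cross3_cross3, real_inner_self_eq_norm_sq]
  simp only [conj_trivial]
  field_simp
  ring
end
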